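/- arXiv:1601.06264 — 2 statements merged into one kernel-verified Lean document; each statement's English description precedes it below -/
import Mathlib

section
/- Let I be an ideal of ℝ[X₁,…,Xₙ] and let Λ : ℝ[X₁,…,Xₙ] → ℝ be a positive definite linear functional. Then Λ vanishes on I if and only if Λ vanishes on I(Z(I)). -/
open MeasureTheory

noncomputable def evalR {n : ℕ} (P : MvPolynomial (Fin n) ℝ) (x : Fin n → ℝ) : ℝ :=
  MvPolynomial.eval x P

def IsPosDefR {n : ℕ} (Λ : MvPolynomial (Fin n) ℝ →ₗ[ℝ] ℝ) : Prop :=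
  ∀ P : MvPolynomial (Fin n) ℝ, 0 ≤ Λ (P ^ 2)

def IsMomentR {n : ℕ} (Λ : MvPolynomial (Fin n) ℝ →ₗ[ℝ] ℝ) : Prop :=
  ∃ μ : Measure (Fin n → ℝ),
    (∀ Q : MvPolynomial (Fin n) ℝ, Integrable (fun x => evalR Q x) μ) ∧
    (∀ Q : MvPolynomial (Fin n) ℝ, Λ Q = ∫ x, evalR Q x ∂μ)

noncomputable def vanishingIdealR {n : ℕ} (Z : Set (Fin n → ℝ)) :
    Ideal (MvPolynomial (Fin n) ℝ) where
  carrier := {P | ∀ x ∈ Z, evalR P x = 0}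
  add_mem' := by
    intro a b ha hb x hx
    simp only [Set.mem_setOf_eq, evalR, map_add] at *
    rw [ha x hx, hb x hx, add_zero]
  zero_mem' := by
    intro x hx
    simp [evalR]
  smul_mem' := by
    intro c a ha x hx
    simp only [Set.mem_setOf_eq, evalR, smul_eq_mul, map_mul] at *
    rw [ha x hx, mul_zero]

def zeroSetR {n : ℕ} (I : Ideal (MvPolynomial (Fin n) ℝ)) : Set (Fin n → ℝ) :=
  {x | ∀ P ∈ I, evalR P x = 0}

def zSetR {n : ℕ} (P : MvPolynomial (Fin n) ℝ) : Set (Fin n → ℝ) :=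
  {x | evalR P x = 0}

def VanishesOnR {n : ℕ} (Λ : MvPolynomial (Fin n) ℝ →ₗ[ℝ] ℝ)
    (I : Ideal (MvPolynomial (Fin n) ℝ)) : Prop :=
  ∀ P ∈ I, Λ P = 0

def nSetR {n : ℕ} (Λ : MvPolynomial (Fin n) ℝ →ₗ[ℝ] ℝ) : Set (MvPolynomial (Fin n) ℝ) :=
  {P | Λ (P ^ 2) = 0}

def IsTypeAR {n : ℕ} (P : MvPolynomial (Fin n) ℝ) : Prop :=
  ∀ Λ : MvPolynomial (Fin n) ℝ →ₗ[ℝ] ℝ,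
    IsPosDefR Λ → VanishesOnR Λ (Ideal.span {P}) → IsMomentR Λ

section

open Polynomial

/-- An ordered field whose polynomials satisfy the intermediate value property. -/
def PolyIVT (R : Type*) [Field R] [LinearOrder R] : Prop :=
  ∀ (F : R[X]) (a b : R), a < b → F.eval a * F.eval b < 0 → ∃ c, a < c ∧ c < b ∧ F.eval c = 0

namespace PolyIVT

variable {R : Type*} [Field R] [LinearOrder R] [IsStrictOrderedRing R]

lemma eval_mul_eval_pos (hR : PolyIVT R) {F : R[X]} {a b : R} (hab : a ≤ b)
    (h : ∀ c, a ≤ c → c ≤ b → F.eval c ≠ 0) : 0 < F.eval a * F.eval b := by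
  have ha := h a le_rfl hab
  have hb := h b hab le_rfl
  rcases hab.eq_or_lt with rfl | hab
  · exact mul_self_pos.2 ha
  · by_contra hneg
    obtain ⟨c, h1, h2, h3⟩ := hR F a b hab (lt_of_le_of_ne (not_lt.1 hneg) (mul_ne_zero ha hb))
    exact h c h1.le h2.le h3

lemma exists_root_derivative (hR : PolyIVT R) {F : R[X]} (hF : F ≠ 0) {u v : R} (huv : u < v)
    (hu : F.eval u = 0) (hv : F.eval v = 0) :
    ∃ w, u < w ∧ w < v ∧ F.derivative.eval w = 0 := by
  classical
  obtain ⟨v', hv', hmin⟩ := (F.roots.toFinset.filter (u < ·)).exists_min_image id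
    ⟨v, by simp [hF, huv, hv]⟩
  simp only [Finset.mem_filter, Multiset.mem_toFinset, mem_roots hF, IsRoot.def, id, and_imp]
    at hv' hmin
  obtain ⟨hv'0, huv'⟩ := hv'
  have hle : v' ≤ v := hmin v hv huv
  obtain ⟨q, hq, hqu⟩ := exists_eq_pow_rootMultiplicity_mul_and_not_dvd F hF u
  have hk : 0 < F.rootMultiplicity u := (rootMultiplicity_pos hF).2 hu
  have hq0 : q ≠ 0 := by rintro rfl; simp at hqu
  have hqv : q.eval v' = 0 := by
    rw [hq] at hv'0
    simpa [sub_ne_zero.2 huv'.ne'] using hv'0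
  obtain ⟨g, hg, hgv⟩ := exists_eq_pow_rootMultiplicity_mul_and_not_dvd q hq0 v'
  have hl : 0 < q.rootMultiplicity v' := (rootMultiplicity_pos hq0).2 hqv
  obtain ⟨k, hk'⟩ := Nat.exists_eq_add_one.2 hk
  obtain ⟨l, hl'⟩ := Nat.exists_eq_add_one.2 hl
  rw [hk'] at hq
  rw [hl'] at hg
  rw [dvd_iff_isRoot, IsRoot.def] at hqu hgv
  have hgu : g.eval u ≠ 0 := by
    intro h; apply hqu; rw [hg]; simp [h]
  have hgpos : 0 < g.eval u * g.eval v' := by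
    refine hR.eval_mul_eval_pos huv'.le fun c h1 h2 h3 => ?_
    have hFc : F.eval c = 0 := by rw [hq, hg]; simp [h3]
    rcases h1.eq_or_lt with rfl | h1
    · exact hgu h3
    · have := hmin c hFc h1
      obtain rfl := le_antisymm h2 this
      exact hgv h3
  let H : R[X] := ((k + 1 : R[X]) * (X - C v') + (l + 1 : R[X]) * (X - C u)) * g
    + (X - C u) * (X - C v') * derivative g
  have hder : derivative F = (X - C u) ^ k * (X - C v') ^ l * H := by
    rw [hq, hg]
    simp only [derivative_mul, derivative_X_sub_C_pow, H]
    simp only [Nat.add_sub_cancel]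
    push_cast
    simp only [map_add, map_natCast, map_one]
    ring
  have hHu : H.eval u = (k + 1) * (u - v') * g.eval u := by simp [H]
  have hHv : H.eval v' = (l + 1) * (v' - u) * g.eval v' := by simp [H]
  obtain ⟨w, h1, h2, h3⟩ := hR H u v' huv' (by
    rw [hHu, hHv]
    have h1 : (0:R) < (k + 1) * (l + 1) * ((v' - u) * (v' - u)) * (g.eval u * g.eval v') := by
      have := sub_pos.2 huv'
      positivity
    nlinarith)
  exact ⟨w, h1, h2.trans_le hle, by rw [hder]; simp [h3]⟩

lemma exists_eq_mul_of_derivative_ne_zero (hR : PolyIVT R) {F : R[X]} {a y b : R} (hay : a < y)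
    (hyb : y < b) (hy : F.eval y = 0) (hd : ∀ w, a < w → w < b → F.derivative.eval w ≠ 0) :
    ∃ g : R[X], F = (X - C y) * g ∧ ∀ r, a ≤ r → r ≤ b → 0 < g.eval a * g.eval r := by
  obtain ⟨g, hg⟩ := dvd_iff_isRoot.2 hy
  have hF : F ≠ 0 := by rintro rfl; exact hd y hay hyb (by simp)
  have hroot : ∀ r, a ≤ r → r ≤ b → g.eval r ≠ 0 := by
    intro r har hrb hr
    have hFr : F.eval r = 0 := by rw [hg]; simp [hr]
    rcases lt_trichotomy r y with h | rfl | h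
    · obtain ⟨w, h1, h2, h3⟩ := hR.exists_root_derivative hF h hFr hy
      exact hd w (har.trans_lt h1) (h2.trans hyb) h3
    · exact hd r hay hyb (by rw [hg]; simp [hr])
    · obtain ⟨w, h1, h2, h3⟩ := hR.exists_root_derivative hF h hy hFr
      exact hd w (hay.trans h1) (h2.trans_le hrb) h3
  exact ⟨g, hg, fun r har hrb => hR.eval_mul_eval_pos har fun c h1 h2 => hroot c h1 (h2.trans hrb)⟩

end PolyIVT

lemma exists_forall_lt_iff {K Ω : Type*} [Field K] [LinearOrder K] [IsStrictOrderedRing K]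
    [LinearOrder Ω] {φ : K → Ω} (hφ : StrictMono φ) (D : Finset K) {y : Ω}
    (hy : ∀ d ∈ D, y ≠ φ d) : ∃ c, ∀ d ∈ D, d ≠ c ∧ (φ d < y ↔ d < c) := by
  classical
  obtain ⟨c, h1, h2⟩ := Order.exists_between_finsets (D.filter (φ · < y)) (D.filter (y < φ ·))
    (by
      intro x hx z hz
      simp only [Finset.mem_filter] at hx hz
      exact hφ.lt_iff_lt.1 (hx.2.trans hz.2))
  refine ⟨c, fun d hd => ?_⟩
  rcases lt_or_gt_of_ne (hy d hd) with h | h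
  · have := h2 d (by simp [hd, h])
    exact ⟨this.ne', by simp [h.not_gt, this.not_gt]⟩
  · have := h1 d (by simp [hd, h])
    exact ⟨this.ne, by simp [h, this]⟩

section

variable {K Ω G : Type*} [Field K] [LinearOrder K] [IsStrictOrderedRing K]
  [Field Ω] [LinearOrder Ω] [IsStrictOrderedRing Ω] [Field G] [LinearOrder G] [IsStrictOrderedRing G]

/-- Every root in `Ω` of a nonzero polynomial over `K` of degree at most `m` comes from `K`. -/
def RootsIn (φ : K →+* Ω) (m : ℕ) : Prop :=
  ∀ h : K[X], h ≠ 0 → h.natDegree ≤ m → ∀ y, h.eval₂ φ y = 0 → ∃ d, φ d = y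

lemma pos_map_iff {φ : K →+* Ω} (hφ : StrictMono φ) {x : K} : 0 < φ x ↔ 0 < x := by
  rw [← map_zero φ, hφ.lt_iff_lt]

lemma eval₂_pos_iff (hΩ : PolyIVT Ω) {φ : K →+* Ω} (hφ : StrictMono φ) {h : K[X]}
    (hr : ∀ y, h.eval₂ φ y = 0 → ∃ d, φ d = y) {y : Ω} {c : K}
    (hc : ∀ d, h.eval d = 0 → d ≠ c ∧ (φ d < y ↔ d < c)) (hy : ∀ d, h.eval d = 0 → y ≠ φ d) :
    0 < h.eval₂ φ y ↔ 0 < h.eval c := by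
  have key : ∀ x, h.eval₂ φ x = 0 → x ≠ φ c ∧ x ≠ y ∧ (x < y ↔ x < φ c) := by
    intro x hx
    obtain ⟨d, rfl⟩ := hr x hx
    have hd : h.eval d = 0 := by
      rw [eval₂_at_apply] at hx
      exact (map_eq_zero φ).1 hx
    have h1 := hc d hd
    exact ⟨fun h => h1.1 (φ.injective h), (hy d hd).symm, by rw [h1.2, hφ.lt_iff_lt]⟩
  have hpos : 0 < h.eval₂ φ y * h.eval₂ φ (φ c) := by
    rw [← eval_map, ← eval_map]
    rcases le_total y (φ c) with hle | hle
    · exact hΩ.eval_mul_eval_pos hle fun x h1 h2 h3 => by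
        obtain ⟨k1, k2, k3⟩ := key x (by rwa [eval_map] at h3)
        exact h1.not_gt (k3.2 (lt_of_le_of_ne h2 k1))
    · rw [mul_comm]
      exact hΩ.eval_mul_eval_pos hle fun x h1 h2 h3 => by
        obtain ⟨k1, k2, k3⟩ := key x (by rwa [eval_map] at h3)
        exact h1.not_gt (k3.1 (lt_of_le_of_ne h2 k2))
  rw [eval₂_at_apply] at hpos
  rw [← pos_map_iff hφ]
  rcases mul_pos_iff.1 hpos with h | h
  · simp [h.1, h.2]
  · exact iff_of_false h.1.not_gt h.2.not_gt

lemma exists_abs_le_of_root {φ : K →+* Ω} (hφ : StrictMono φ) {F : K[X]} (hF : F ≠ 0) {y : Ω}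
    (hy : F.eval₂ φ y = 0) : ∃ B, |y| ≤ φ B := by
  by_contra! hB
  suffices H : ∀ (n : ℕ) (h : K[X]), h.natDegree ≤ n → h ≠ 0 → ∃ ε, 0 < ε ∧ φ ε ≤ |h.eval₂ φ y| by
    obtain ⟨ε, h1, h2⟩ := H _ F le_rfl hF
    rw [hy, abs_zero] at h2
    exact h2.not_gt ((pos_map_iff hφ).2 h1)
  have habs : ∀ a : K, |φ a| = φ |a| := fun a => by
    rcases le_total 0 a with h | h
    · rw [abs_of_nonneg h, abs_of_nonneg (by simpa using hφ.monotone h)]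
    · rw [abs_of_nonpos h, abs_of_nonpos (by simpa using hφ.monotone h), map_neg]
  have hconst : ∀ a : K, a ≠ 0 → ∃ ε, 0 < ε ∧ φ ε ≤ |(C a).eval₂ φ y| := fun a ha =>
    ⟨|a|, abs_pos.2 ha, by simp [habs]⟩
  intro n
  induction n with
  | zero =>
    intro h hd h0
    rw [eq_C_of_natDegree_le_zero hd] at h0 ⊢
    exact hconst _ (by simpa using h0)
  | succ n ih =>
    intro h hd h0
    rw [← divX_mul_X_add h] at h0 ⊢
    by_cases hx : h.divX = 0
    · rw [hx] at h0 ⊢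
      simp only [zero_mul, zero_add] at h0 ⊢
      exact hconst _ (by simpa using h0)
    · obtain ⟨ε, hε, hle⟩ := ih h.divX (by rw [natDegree_divX_eq_natDegree_tsub_one]; omega) hx
      refine ⟨1, one_pos, ?_⟩
      have h1 := hB ((|h.coeff 0| + 1) / ε)
      have h2 : φ (|h.coeff 0| + 1) ≤ |h.divX.eval₂ φ y * y| := by
        rw [abs_mul]
        calc φ (|h.coeff 0| + 1) = φ ε * φ ((|h.coeff 0| + 1) / ε) := by
              rw [← map_mul]; congr 1; field_simp
          _ ≤ _ := by
              refine mul_le_mul hle h1.le ?_ (abs_nonneg _)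
              rw [← map_zero φ]
              exact hφ.monotone (by positivity)
      rw [map_add, ← habs] at h2
      simp only [eval₂_add, eval₂_mul, eval₂_X, eval₂_C]
      have h3 := abs_sub_abs_le_abs_sub (h.divX.eval₂ φ y * y) (-φ (h.coeff 0))
      rw [abs_neg, sub_neg_eq_add] at h3
      linarith

/-- The pair of embeddings `φ`, `ψ` cannot be extended by a pair of points at which
the polynomials over `K` have the same signs. -/
def MaximalPair (φ : K →+* Ω) (ψ : K →+* G) : Prop :=
  ∀ y z, (∀ h : K[X], 0 < h.eval₂ φ y ↔ 0 < h.eval₂ ψ z) → (∃ d, φ d = y) ∧ ∃ d, ψ d = z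

lemma MaximalPair.symm {φ : K →+* Ω} {ψ : K →+* G} (h : MaximalPair φ ψ) : MaximalPair ψ φ :=
  fun y z hyz => (h z y fun k => (hyz k).symm).symm

lemma MaximalPair.rootsIn_succ_left {φ : K →+* Ω} {ψ : K →+* G} (hmax : MaximalPair φ ψ)
    (hφ : StrictMono φ) (hψ : StrictMono ψ) (hΩ : PolyIVT Ω) (hG : PolyIVT G) {m : ℕ}
    (h1 : RootsIn φ m) (h2 : RootsIn ψ m) : RootsIn φ (m + 1) := by
  classical
  intro F hF hdeg y hy
  by_contra! hyK
  have hF' : derivative F ≠ 0 := by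
    intro h0
    have := derivative_eq_zero.1 h0
    obtain ⟨d, hd⟩ := h1 F hF (by omega) y hy
    exact hyK d hd
  have hdeg' : (derivative F).natDegree ≤ m :=
    (natDegree_derivative_le F).trans (by omega)
  obtain ⟨B, hB⟩ := exists_abs_le_of_root hφ hF hy
  obtain ⟨hB1, hB2⟩ := abs_le.1 hB
  let D : Finset K := insert (-B) (insert B (derivative F).roots.toFinset)
  obtain ⟨a, ha, hamax⟩ := (D.filter (φ · < y)).exists_max_image id
    ⟨-B, by simpa [D] using lt_of_le_of_ne hB1 (by simpa using hyK (-B))⟩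
  obtain ⟨b, hb, hbmin⟩ := (D.filter (y < φ ·)).exists_min_image id
    ⟨B, by simpa [D] using lt_of_le_of_ne hB2 (hyK B).symm⟩
  simp only [Finset.mem_filter, id, and_imp] at ha hamax hb hbmin
  have hgap : ∀ d, (derivative F).eval d = 0 → d ≤ a ∨ b ≤ d := by
    intro d hd
    have hdD : d ∈ D := by simp [D, hF', hd]
    rcases lt_or_gt_of_ne (hyK d) with h | h
    · exact Or.inl (hamax d hdD h)
    · exact Or.inr (hbmin d hdD h)
  have hdφ : ∀ w, φ a < w → w < φ b → (derivative (F.map φ)).eval w ≠ 0 := by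
    intro w hw1 hw2 hw
    rw [derivative_map, eval_map] at hw
    obtain ⟨d, rfl⟩ := h1 _ hF' hdeg' w hw
    rw [eval₂_at_apply, map_eq_zero] at hw
    rcases hgap d hw with h | h
    · exact (hφ.monotone h).not_gt hw1
    · exact (hφ.monotone h).not_gt hw2
  have hdψ : ∀ w, ψ a < w → w < ψ b → (derivative (F.map ψ)).eval w ≠ 0 := by
    intro w hw1 hw2 hw
    rw [derivative_map, eval_map] at hw
    obtain ⟨d, rfl⟩ := h2 _ hF' hdeg' w hw
    rw [eval₂_at_apply, map_eq_zero] at hw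
    rcases hgap d hw with h | h
    · exact (hψ.monotone h).not_gt hw1
    · exact (hψ.monotone h).not_gt hw2
  obtain ⟨g, hg, hgpos⟩ := hΩ.exists_eq_mul_of_derivative_ne_zero ha.2 hb.2
    (by rwa [eval_map]) hdφ
  have hab : a < b := hφ.lt_iff_lt.1 (ha.2.trans hb.2)
  have hφF : ∀ r, φ (F.eval r) = (φ r - y) * g.eval (φ r) := fun r => by
    rw [← eval₂_at_apply, ← eval_map, hg]; simp
  have hFab : F.eval a * F.eval b < 0 := by
    rw [← hφ.lt_iff_lt, map_zero, map_mul, hφF, hφF]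
    have := hgpos (φ b) (hφ.monotone hab.le) le_rfl
    nlinarith [mul_pos (mul_pos (sub_pos.2 ha.2) (sub_pos.2 hb.2)) this]
  obtain ⟨z, haz, hzb, hz⟩ := hG (F.map ψ) (ψ a) (ψ b) (hψ hab) (by
    rw [eval_map, eval_map, eval₂_at_apply, eval₂_at_apply, ← map_mul, ← map_zero ψ]
    exact hψ hFab)
  obtain ⟨k, hk, hkpos⟩ := hG.exists_eq_mul_of_derivative_ne_zero haz hzb hz hdψ
  have hψF : ∀ r, ψ (F.eval r) = (ψ r - z) * k.eval (ψ r) := fun r => by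
    rw [← eval₂_at_apply, ← eval_map, hk]; simp
  have hzK : ∀ d, ψ d ≠ z := by
    rintro d rfl
    have hd : F.eval d = 0 := by simpa using hψF d
    have := hφF d
    rw [hd, map_zero, eq_comm, mul_eq_zero, sub_eq_zero] at this
    have hpos := hgpos (φ d) (hφ (hψ.lt_iff_lt.1 haz)).le (hφ (hψ.lt_iff_lt.1 hzb)).le
    rcases this with h | h
    · exact hyK d h
    · simp [h] at hpos
  have hcut : ∀ r, φ r < y ↔ ψ r < z := by
    intro r
    rcases le_or_gt r a with hra | hra
    · simp [(hφ.monotone hra).trans_lt ha.2, (hψ.monotone hra).trans_lt haz]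
    rcases le_or_gt b r with hbr | hbr
    · exact iff_of_false (hb.2.trans_le (hφ.monotone hbr)).not_gt
        (hzb.trans_le (hψ.monotone hbr)).not_gt
    have e1 : φ r < y ↔ 0 < F.eval a * F.eval r := by
      rw [← pos_map_iff hφ, map_mul, hφF, hφF]
      have := hgpos (φ r) (hφ hra).le (hφ hbr).le
      rcases lt_or_gt_of_ne (hyK r) with h | h
      · simp only [h, true_iff]
        nlinarith [mul_pos (mul_pos (sub_pos.2 ha.2) (sub_pos.2 h)) this]
      · simp only [h.not_gt, false_iff, not_lt]
        nlinarith [mul_pos (mul_pos (sub_pos.2 ha.2) (sub_pos.2 h)) this]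
    have e2 : ψ r < z ↔ 0 < F.eval a * F.eval r := by
      rw [← pos_map_iff hψ, map_mul, hψF, hψF]
      have := hkpos (ψ r) (hψ hra).le (hψ hbr).le
      rcases lt_or_gt_of_ne (hzK r) with h | h
      · simp only [h, true_iff]
        nlinarith [mul_pos (mul_pos (sub_pos.2 haz) (sub_pos.2 h)) this]
      · simp only [h.not_gt, false_iff, not_lt]
        nlinarith [mul_pos (mul_pos (sub_pos.2 haz) (sub_pos.2 h)) this]
    rw [e1, e2]
  obtain ⟨⟨d, hd⟩, -⟩ := hmax y z (by
    intro h
    have hy' : h.eval₂ φ y = (h % F).eval₂ φ y := by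
      conv_lhs => rw [← EuclideanDomain.div_add_mod h F]
      simp [hy]
    have hz' : h.eval₂ ψ z = (h % F).eval₂ ψ z := by
      rw [eval_map] at hz
      conv_lhs => rw [← EuclideanDomain.div_add_mod h F]
      simp [hz]
    rw [hy', hz']
    by_cases hr : h % F = 0
    · simp [hr]
    have hrdeg : (h % F).natDegree ≤ m := by
      have hFd : F.natDegree ≠ 0 := by
        intro h0
        rw [eq_C_of_natDegree_eq_zero h0] at hF'
        simp at hF'
      have := natDegree_mod_lt h hFd
      omega
    obtain ⟨c, hc⟩ := exists_forall_lt_iff hφ (h % F).roots.toFinset (y := y)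
      fun d _ => (hyK d).symm
    replace hc : ∀ d, (h % F).eval d = 0 → d ≠ c ∧ (φ d < y ↔ d < c) :=
      fun d hd => hc d (by simp [hr, hd])
    rw [eval₂_pos_iff hΩ hφ (h1 _ hr hrdeg) hc fun d _ => (hyK d).symm,
      eval₂_pos_iff hG hψ (h2 _ hr hrdeg) (fun d hd => by rw [← hcut]; exact hc d hd)
        fun d _ => (hzK d).symm])
  exact hyK d hd

lemma MaximalPair.rootsIn {φ : K →+* Ω} {ψ : K →+* G} (hmax : MaximalPair φ ψ)
    (hφ : StrictMono φ) (hψ : StrictMono ψ) (hΩ : PolyIVT Ω) (hG : PolyIVT G) (m : ℕ) :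
    RootsIn φ m ∧ RootsIn ψ m := by
  induction m with
  | zero =>
    constructor <;>
    · intro h h0 hd y hy
      rw [eq_C_of_natDegree_le_zero hd] at h0 hy
      simp_all
  | succ m ih =>
    exact ⟨hmax.rootsIn_succ_left hφ hψ hΩ hG ih.1 ih.2,
      hmax.symm.rootsIn_succ_left hψ hφ hG hΩ ih.2 ih.1⟩

end

section

variable {Ω G : Type} [Field Ω] [LinearOrder Ω] [IsStrictOrderedRing Ω]
  [Field G] [LinearOrder G] [IsStrictOrderedRing G]

/-- The two coordinates of every element of `S` have the same sign. -/
def SameSign (S : Subring (Ω × G)) : Prop :=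
  ∀ s ∈ S, 0 < s.1 ↔ 0 < s.2

lemma SameSign.eq_zero_iff {S : Subring (Ω × G)} (hS : SameSign S) {s : Ω × G} (hs : s ∈ S) :
    s.1 = 0 ↔ s.2 = 0 := by
  have h1 := hS s hs
  have h2 := hS (-s) (neg_mem hs)
  simp only [Prod.fst_neg, Prod.snd_neg, neg_pos] at h2
  constructor
  · intro h
    simp only [h, lt_irrefl, false_iff, not_lt] at h1 h2
    exact le_antisymm h1 h2
  · intro h
    simp only [h, lt_irrefl, iff_false, not_lt] at h1 h2
    exact le_antisymm h1 h2

lemma SameSign.ne_zero {S : Subring (Ω × G)} (hS : SameSign S) {s : Ω × G} (hs : s ∈ S)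
    (h0 : s ≠ 0) : s.1 ≠ 0 ∧ s.2 ≠ 0 := by
  have h := hS.eq_zero_iff hs
  constructor
  · exact fun h1 => h0 (Prod.ext h1 (h.1 h1))
  · exact fun h2 => h0 (Prod.ext (h.2 h2) h2)

lemma SameSign.exists_maximal {S₀ : Subring (Ω × G)} (h₀ : SameSign S₀) :
    ∃ S, S₀ ≤ S ∧ Maximal SameSign S := by
  refine zorn_le_nonempty₀ {S : Subring (Ω × G) | SameSign S} ?_ S₀ h₀
  intro c hc hchain T hT
  refine ⟨sSup c, fun s hs => ?_, fun U hU => le_sSup hU⟩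
  obtain ⟨U, hU, hsU⟩ := (Subring.mem_sSup_of_directedOn ⟨T, hT⟩ hchain.directedOn).1 hs
  exact hc hU s hsU

lemma isField_of_maximal {S : Subring (Ω × G)} (hS : Maximal SameSign S) : IsField S := by
  refine ⟨⟨0, 1, zero_ne_one⟩, mul_comm, fun {a} ha => ?_⟩
  have hne : ∀ u ∈ S, u ≠ 0 → u.1 ≠ 0 ∧ u.2 ≠ 0 := fun u hu h0 => hS.prop.ne_zero hu h0
  have hmul : ∀ u ∈ S, ∀ v ∈ S, u ≠ 0 → v ≠ 0 → u * v ≠ 0 := fun u hu v hv h1 h2 h =>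
    mul_ne_zero (hne u hu h1).1 (hne v hv h2).1 (by simpa using congrArg Prod.fst h)
  let S' : Subring (Ω × G) :=
    { carrier := {t | ∃ u ∈ S, u ≠ 0 ∧ t * u ∈ S}
      mul_mem' := by
        rintro t t' ⟨u, hu, h0, htu⟩ ⟨u', hu', h0', htu'⟩
        refine ⟨u * u', mul_mem hu hu', hmul u hu u' hu' h0 h0', ?_⟩
        rw [mul_mul_mul_comm]
        exact mul_mem htu htu'
      one_mem' := ⟨1, one_mem S, one_ne_zero, by simp⟩
      add_mem' := by
        rintro t t' ⟨u, hu, h0, htu⟩ ⟨u', hu', h0', htu'⟩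
        refine ⟨u * u', mul_mem hu hu', hmul u hu u' hu' h0 h0', ?_⟩
        rw [show (t + t') * (u * u') = t * u * u' + t' * u' * u by ring]
        exact add_mem (mul_mem htu hu') (mul_mem htu' hu)
      zero_mem' := ⟨1, one_mem S, one_ne_zero, by simp⟩
      neg_mem' := by
        rintro t ⟨u, hu, h0, htu⟩
        exact ⟨u, hu, h0, by rw [neg_mul]; exact neg_mem htu⟩ }
  have hS' : SameSign S' := by
    rintro t ⟨u, hu, h0, htu⟩
    have h := hS.prop _ (mul_mem htu hu)
    obtain ⟨h1, h2⟩ := hne u hu h0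
    simp only [Prod.fst_mul, Prod.snd_mul, mul_assoc] at h
    rwa [mul_pos_iff_of_pos_right (mul_self_pos.2 h1),
      mul_pos_iff_of_pos_right (mul_self_pos.2 h2)] at h
  have hle : S' ≤ S := hS.le_of_ge hS' fun s hs => ⟨1, one_mem S, one_ne_zero, by simpa using hs⟩
  have ha' : (a : Ω × G) ≠ 0 := by simpa using ha
  obtain ⟨h1, h2⟩ := hne a a.2 ha'
  have hinv : (a : Ω × G) * (a.1.1⁻¹, a.1.2⁻¹) = 1 := by
    ext <;> simp [h1, h2]
  exact ⟨⟨(a.1.1⁻¹, a.1.2⁻¹), hle ⟨a, a.2, ha', by rw [mul_comm, hinv]; exact one_mem S⟩⟩,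
    Subtype.ext hinv⟩

lemma exists_mem_of_maximal {S : Subring (Ω × G)} (hS : Maximal SameSign S) {y : Ω} {z : G}
    (h : ∀ p : S[X], 0 < p.eval₂ ((RingHom.fst Ω G).comp S.subtype) y ↔
      0 < p.eval₂ ((RingHom.snd Ω G).comp S.subtype) z) : (y, z) ∈ S := by
  have hle := hS.le_of_ge (y := (eval₂RingHom S.subtype (y, z)).range) (by
      rintro _ ⟨p, rfl⟩
      have h1 := hom_eval₂ p S.subtype (RingHom.fst Ω G) (y, z)
      have h2 := hom_eval₂ p S.subtype (RingHom.snd Ω G) (y, z)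
      simp only [RingHom.coe_fst, RingHom.coe_snd] at h1 h2
      simp only [coe_eval₂RingHom]
      rw [h1, h2]
      exact h p) (fun s hs => ⟨C ⟨s, hs⟩, by simp⟩)
  exact hle ⟨X, by simp⟩

end

section

variable {ι G : Type} [Field G] [LinearOrder G] [IsStrictOrderedRing G] (U : Ultrafilter ι)

/-- Constant germs, as a ring homomorphism into the ultrapower. -/
noncomputable def germConst : G →+* (U : Filter ι).Germ G :=
  (Filter.Germ.coeRingHom (U : Filter ι)).comp (Pi.constRingHom ι G)

omit [LinearOrder G] [IsStrictOrderedRing G] in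
lemma eval₂_germConst {K : Type} [Field K] (ψ : K →+* G) (h : K[X]) (f : ι → G) :
    h.eval₂ ((germConst U).comp ψ) (f : (U : Filter ι).Germ G)
      = ((fun i => h.eval₂ ψ (f i) : ι → G) : (U : Filter ι).Germ G) := by
  have h1 := hom_eval₂ h ((Pi.constRingHom ι G).comp ψ) (Filter.Germ.coeRingHom (U : Filter ι)) f
  rw [← RingHom.comp_assoc] at h1
  refine h1.symm.trans (congrArg _ (funext fun i => ?_))
  exact hom_eval₂ h ((Pi.constRingHom ι G).comp ψ) (Pi.evalRingHom (fun _ => G) i) f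

omit [LinearOrder G] [IsStrictOrderedRing G] in
lemma mvEval₂_germConst {K σ : Type} [Field K] (ψ : K →+* G) (p : MvPolynomial σ K)
    (f : σ → ι → G) :
    p.eval₂ ((germConst U).comp ψ) (fun j => (f j : (U : Filter ι).Germ G))
      = ((fun i => p.eval₂ ψ (fun j => f j i) : ι → G) : (U : Filter ι).Germ G) := by
  have h1 := MvPolynomial.eval₂_comp_left (Filter.Germ.coeRingHom (U : Filter ι))
    ((Pi.constRingHom ι G).comp ψ) f p
  rw [← RingHom.comp_assoc] at h1
  refine h1.symm.trans (congrArg _ (funext fun i => ?_))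
  exact MvPolynomial.eval₂_comp_left (Pi.evalRingHom (fun _ => G) i)
    ((Pi.constRingHom ι G).comp ψ) f p

lemma PolyIVT.germ (hG : PolyIVT G) : PolyIVT ((U : Filter ι).Germ G) := by
  classical
  intro F a b hab hF
  obtain ⟨F, rfl⟩ := Polynomial.map_surjective (Filter.Germ.coeRingHom (U : Filter ι))
    (fun x => by
    induction x using Filter.Germ.inductionOn with | _ f
    exact ⟨f, rfl⟩) F
  have key : ∀ f : ι → G, (F.map (Filter.Germ.coeRingHom (U : Filter ι))).eval
      (f : (U : Filter ι).Germ G) = ((fun i => (F.map (Pi.evalRingHom (fun _ => G) i)).eval (f i) :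
        ι → G) : (U : Filter ι).Germ G) := by
    intro f
    rw [eval_map]
    refine (eval₂_at_apply _ _).trans (congrArg _ (funext fun i => ?_))
    rw [eval_map]
    exact (eval₂_at_apply (Pi.evalRingHom (fun _ => G) i) f).symm
  induction a using Filter.Germ.inductionOn with | _ a
  induction b using Filter.Germ.inductionOn with | _ b
  rw [key, key, ← Filter.Germ.coe_mul, ← Filter.Germ.coe_zero, Filter.Germ.coe_lt] at hF
  rw [Filter.Germ.coe_lt] at hab
  have : ∀ i, ∃ c, a i < b i ∧ (F.map (Pi.evalRingHom (fun _ => G) i)).eval (a i) *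
      (F.map (Pi.evalRingHom (fun _ => G) i)).eval (b i) < 0 → a i < c ∧ c < b i ∧
      (F.map (Pi.evalRingHom (fun _ => G) i)).eval c = 0 := by
    intro i
    by_cases h : a i < b i ∧ (F.map (Pi.evalRingHom (fun _ => G) i)).eval (a i) *
      (F.map (Pi.evalRingHom (fun _ => G) i)).eval (b i) < 0
    · obtain ⟨c, hc⟩ := hG _ _ _ h.1 h.2
      exact ⟨c, fun _ => hc⟩
    · exact ⟨0, fun h' => (h h').elim⟩
  choose c hc using this
  refine ⟨(c : (U : Filter ι).Germ G), ?_, ?_, ?_⟩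
  · rw [Filter.Germ.coe_lt]
    filter_upwards [hab, hF] with i h1 h2 using (hc i ⟨h1, h2⟩).1
  · rw [Filter.Germ.coe_lt]
    filter_upwards [hab, hF] with i h1 h2 using (hc i ⟨h1, h2⟩).2.1
  · rw [key, ← Filter.Germ.coe_zero, Filter.Germ.coe_eq]
    filter_upwards [hab, hF] with i h1 h2 using (hc i ⟨h1, h2⟩).2.2

end

lemma polyIVT_real : PolyIVT ℝ := by
  intro F a b hab hF
  have hcont : ContinuousOn (fun x => F.eval x) (Set.Icc a b) := F.continuous.continuousOn
  rcases mul_neg_iff.1 hF with ⟨h1, h2⟩ | ⟨h1, h2⟩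
  · obtain ⟨c, hc, h⟩ := intermediate_value_Ioo' hab.le hcont ⟨h2, h1⟩
    exact ⟨c, hc.1, hc.2, h⟩
  · obtain ⟨c, hc, h⟩ := intermediate_value_Ioo hab.le hcont ⟨h1, h2⟩
    exact ⟨c, hc.1, hc.2, h⟩

/-- Finite systems of polynomial equations and an inequation over `ℝ` that are solvable in `G`
are solvable in `ℝ`. -/
def TransfersToReal {G : Type} [Field G] (ψ : ℝ →+* G) (n : ℕ) : Prop :=
  ∀ (s : Finset (MvPolynomial (Fin n) ℝ)) (g : MvPolynomial (Fin n) ℝ) (x : Fin n → G),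
    (∀ p ∈ s, p.eval₂ ψ x = 0) → g.eval₂ ψ x ≠ 0 →
      ∃ x : Fin n → ℝ, (∀ p ∈ s, MvPolynomial.eval x p = 0) ∧ MvPolynomial.eval x g ≠ 0

lemma TransfersToReal.germ {ι G : Type} [Field G] {ψ : ℝ →+* G}
    {n : ℕ} (h : TransfersToReal ψ n) (U : Ultrafilter ι) :
    TransfersToReal ((germConst U).comp ψ) n := by
  intro s g x hs hg
  have : ∀ j, ∃ f : ι → G, (f : (U : Filter ι).Germ G) = x j := fun j =>
    Quotient.inductionOn' (x j) fun f => ⟨f, rfl⟩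
  choose f hf using this
  obtain rfl : (fun j => (f j : (U : Filter ι).Germ G)) = x := funext hf
  have hs' : ∀ᶠ i in (U : Filter ι), ∀ p ∈ s, p.eval₂ ψ (fun j => f j i) = 0 := by
    rw [Filter.eventually_all_finset]
    intro p hp
    have := hs p hp
    rwa [mvEval₂_germConst, ← Filter.Germ.coe_zero, Filter.Germ.coe_eq] at this
  have hg' : ∀ᶠ i in (U : Filter ι), g.eval₂ ψ (fun j => f j i) ≠ 0 := by
    rw [Ultrafilter.eventually_not]
    intro h
    exact hg (by rw [mvEval₂_germConst, ← Filter.Germ.coe_zero, Filter.Germ.coe_eq]; exact h)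
  obtain ⟨i, h1, h2⟩ := (hs'.and hg').exists
  exact h s g _ h1 h2

section

variable {Ω : Type} [Field Ω] [LinearOrder Ω] [IsStrictOrderedRing Ω]

/-- The points of `V` lie in a subring of `Ω` over `ℝ` which embeds, with signs preserved,
into an ordered field with the intermediate value property from which solvability of
polynomial systems in `n` variables transfers to `ℝ`. -/
def Embeds (φ : ℝ →+* Ω) (n : ℕ) (V : Set Ω) : Prop :=
  ∃ (G : Type) (_ : Field G) (_ : LinearOrder G) (_ : IsStrictOrderedRing G) (ψ : ℝ →+* G)
    (S : Subring (Ω × G)), PolyIVT G ∧ TransfersToReal ψ n ∧ SameSign S ∧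
      (∀ r, (φ r, ψ r) ∈ S) ∧ ∀ v ∈ V, ∃ z, (v, z) ∈ S

lemma embeds_empty (φ : ℝ →+* Ω) (n : ℕ) : Embeds φ n ∅ := by
  refine ⟨ℝ, inferInstance, inferInstance, inferInstance, RingHom.id ℝ,
    (φ.prod (RingHom.id ℝ)).range, polyIVT_real, ?_, ?_, fun r => ⟨r, rfl⟩, by simp⟩
  · intro s g x hs hg
    exact ⟨x, hs, hg⟩
  · rintro _ ⟨r, rfl⟩
    simp only [RingHom.prod_apply, RingHom.id_apply]
    have hnonneg : ∀ r : ℝ, 0 ≤ r → 0 ≤ φ r := fun r hr => by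
      rw [← Real.mul_self_sqrt hr, map_mul]
      exact mul_self_nonneg _
    refine ⟨fun h => ?_, fun h => lt_of_le_of_ne (hnonneg r h.le) ?_⟩
    · by_contra h'
      have := hnonneg (-r) (by linarith)
      rw [map_neg] at this
      linarith
    · exact fun h0 => h.ne' ((map_eq_zero φ).1 h0.symm)

lemma exists_maximalPair {G : Type} [Field G] [LinearOrder G] [IsStrictOrderedRing G]
    {S : Subring (Ω × G)} (hS : Maximal SameSign S) :
    ∃ (K : Type) (_ : Field K) (_ : LinearOrder K) (_ : IsStrictOrderedRing K)
      (θ : K →+* Ω) (η : K →+* G), StrictMono θ ∧ StrictMono η ∧ MaximalPair θ η ∧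
        (∀ s ∈ S, ∃ k, θ k = s.1 ∧ η k = s.2) ∧ ∀ k, (θ k, η k) ∈ S := by
  -- Pass to an isomorphic copy, as `S` already carries the product order.
  obtain ⟨K, _, e, -⟩ : ∃ (K : Type) (_ : CommRing K) (_ : K ≃+* S), True :=
    ⟨S, inferInstance, RingEquiv.refl S, trivial⟩
  let _ : Field K := (e.toMulEquiv.isField (isField_of_maximal hS)).toField
  let θ : K →+* Ω := ((RingHom.fst Ω G).comp S.subtype).comp e
  let η : K →+* G := ((RingHom.snd Ω G).comp S.subtype).comp e
  let _ : LinearOrder K := LinearOrder.lift' θ θ.injective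
  have hθ : StrictMono θ := fun _ _ h => h
  have : IsStrictOrderedRing K :=
    Function.Injective.isStrictOrderedRing θ (map_zero θ) (map_one θ) (map_add θ) (map_mul θ)
      Iff.rfl Iff.rfl
  refine ⟨K, inferInstance, inferInstance, this, θ, η, hθ, ?_, ?_, ?_, fun k => (e k).2⟩
  · intro a b hab
    rw [← sub_pos, ← map_sub]
    refine (hS.prop _ (e (b - a)).2).1 ?_
    have := hθ hab
    rwa [← sub_pos, ← map_sub] at this
  · intro y z hyz
    have hmem : (y, z) ∈ S := exists_mem_of_maximal hS fun p => by
      have h1 := eval₂_map (p := p) (f := (e.symm : S →+* K)) θ y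
      have h2 := eval₂_map (p := p) (f := (e.symm : S →+* K)) η z
      have e1 : θ.comp (e.symm : S →+* K) = (RingHom.fst Ω G).comp S.subtype := by
        ext s; simp [θ]
      have e2 : η.comp (e.symm : S →+* K) = (RingHom.snd Ω G).comp S.subtype := by
        ext s; simp [η]
      rw [e1] at h1
      rw [e2] at h2
      rw [← h1, ← h2]
      exact hyz _
    exact ⟨⟨e.symm ⟨_, hmem⟩, by simp [θ]⟩, ⟨e.symm ⟨_, hmem⟩, by simp [η]⟩⟩
  · intro s hs
    exact ⟨e.symm ⟨s, hs⟩, by simp [θ], by simp [η]⟩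

lemma Embeds.insert (hΩ : PolyIVT Ω) {φ : ℝ →+* Ω} {n : ℕ} {V : Set Ω} (h : Embeds φ n V) (y : Ω) :
    Embeds φ n (insert y V) := by
  classical
  obtain ⟨G, _, _, _, ψ, S₀, hG, hψ, hS₀, hr, hV⟩ := h
  obtain ⟨S, hle, hS⟩ := hS₀.exists_maximal
  obtain ⟨K, _, _, _, θ, η, hθ, hη, hmax, hSK, hKS⟩ := exists_maximalPair hS
  by_cases hy : ∃ d, θ d = y
  · obtain ⟨d, rfl⟩ := hy
    refine ⟨G, inferInstance, inferInstance, inferInstance, ψ, S, hG, hψ, hS.prop, fun r => hle (hr r), ?_⟩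
    rintro v (rfl | hv)
    · exact ⟨η d, hKS d⟩
    · obtain ⟨z, hz⟩ := hV v hv
      exact ⟨z, hle hz⟩
  push Not at hy
  have : ∀ D : Finset K, ∃ c, ∀ d ∈ D, d ≠ c ∧ (θ d < y ↔ d < c) := fun D =>
    exists_forall_lt_iff hθ D fun d _ => (hy d).symm
  choose c hc using this
  let U : Ultrafilter (Finset K) := Ultrafilter.of Filter.atTop
  let z : (U : Filter (Finset K)).Germ G := ((fun D => η (c D) : Finset K → G) : Filter.Germ _ G)
  have hsign : ∀ h : K[X], 0 < h.eval₂ θ y ↔ 0 < h.eval₂ ((germConst U).comp η) z := by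
    intro h
    by_cases h0 : h = 0
    · simp [h0]
    rw [eval₂_germConst, Filter.Germ.coe_pos]
    have hev : ∀ᶠ D in (U : Filter (Finset K)),
        (0 < h.eval₂ η (η (c D)) ↔ 0 < h.eval₂ θ y) := by
      have := Ultrafilter.of_le _ (Filter.eventually_ge_atTop h.roots.toFinset)
      filter_upwards [this] with D hD
      rw [eval₂_at_apply, pos_map_iff hη, eval₂_pos_iff hΩ hθ
        ((hmax.rootsIn hθ hη hΩ hG h.natDegree).1 h h0 le_rfl)
        (fun d hd => hc D d (hD (by simp [h0, hd]))) fun d _ => (hy d).symm]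
    rw [Filter.eventually_congr hev, Filter.eventually_const]
  refine ⟨(U : Filter (Finset K)).Germ G, inferInstance, inferInstance, inferInstance,
    (germConst U).comp ψ, (eval₂RingHom (θ.prod ((germConst U).comp η)) (y, z)).range,
    hG.germ U, hψ.germ U, ?_, ?_, ?_⟩
  · rintro _ ⟨p, rfl⟩
    have h1 := hom_eval₂ p (θ.prod ((germConst U).comp η)) (RingHom.fst Ω _) (y, z)
    have h2 := hom_eval₂ p (θ.prod ((germConst U).comp η)) (RingHom.snd Ω _) (y, z)
    simp only [RingHom.coe_fst, RingHom.coe_snd, RingHom.fst_comp_prod, RingHom.snd_comp_prod]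
      at h1 h2
    simp only [coe_eval₂RingHom]
    rw [h1, h2]
    exact hsign p
  · intro r
    obtain ⟨k, h1, h2⟩ := hSK _ (hle (hr r))
    exact ⟨C k, by simp_all⟩
  · rintro v (rfl | hv)
    · exact ⟨z, X, by simp⟩
    · obtain ⟨w, hw⟩ := hV v hv
      obtain ⟨k, h1, h2⟩ := hSK _ (hle hw)
      exact ⟨germConst U w, C k, by simp_all⟩

lemma exists_real_point (hΩ : PolyIVT Ω) {φ : ℝ →+* Ω} {n : ℕ} (s : Finset (MvPolynomial (Fin n) ℝ))
    (g : MvPolynomial (Fin n) ℝ) (x : Fin n → Ω) (hs : ∀ p ∈ s, p.eval₂ φ x = 0)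
    (hg : g.eval₂ φ x ≠ 0) :
    ∃ x : Fin n → ℝ, (∀ p ∈ s, MvPolynomial.eval x p = 0) ∧ MvPolynomial.eval x g ≠ 0 := by
  classical
  have hfin : ∀ T : Finset Ω, Embeds φ n T := by
    intro T
    induction T using Finset.induction_on with
    | empty => simpa using embeds_empty φ n
    | insert y T _ ih => simpa using ih.insert hΩ y
  obtain ⟨G, _, _, _, ψ, S, hG, hψ, hS, hr, hV⟩ := hfin (Finset.univ.image x)
  have : ∀ j, ∃ z, (x j, z) ∈ S := fun j => hV _ (by simp)
  choose z hz using this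
  have hmem : ∀ p : MvPolynomial (Fin n) ℝ, (p.eval₂ φ x, p.eval₂ ψ z) ∈ S := by
    intro p
    induction p using MvPolynomial.induction_on with
    | C a => simpa using hr a
    | add p q hp hq => simpa using add_mem hp hq
    | mul_X p j hp => simpa using mul_mem hp (hz j)
  exact hψ s g z (fun p hp => (hS.eq_zero_iff (hmem p)).1 (hs p hp))
    fun h => hg ((hS.eq_zero_iff (hmem g)).2 h)

end

section

variable {A : Type*} [CommRing A]

/-- The subsemiring generated by `T` and `a`, when `T` contains all squares. -/
def adjoinCone (T : Subsemiring A) (hT : ∀ x, x * x ∈ T) (a : A) : Subsemiring A where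
  carrier := {x | ∃ s ∈ T, ∃ t ∈ T, x = s + a * t}
  mul_mem' := by
    rintro _ _ ⟨s, hs, t, ht, rfl⟩ ⟨s', hs', t', ht', rfl⟩
    exact ⟨s * s' + a * a * (t * t'),
      add_mem (mul_mem hs hs') (mul_mem (hT a) (mul_mem ht ht')), s * t' + s' * t,
      add_mem (mul_mem hs ht') (mul_mem hs' ht), by ring⟩
  one_mem' := ⟨1, one_mem T, 0, zero_mem T, by ring⟩
  add_mem' := by
    rintro _ _ ⟨s, hs, t, ht, rfl⟩ ⟨s', hs', t', ht', rfl⟩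
    exact ⟨s + s', add_mem hs hs', t + t', add_mem ht ht', by ring⟩
  zero_mem' := ⟨0, zero_mem T, 0, zero_mem T, by ring⟩

/-- A prime cone of a commutative ring. -/
structure IsPrimeCone (T : Subsemiring A) : Prop where
  total : ∀ x, x ∈ T ∨ -x ∈ T
  prime : ∀ x y, x * y ∈ T → -(x * y) ∈ T → (x ∈ T ∧ -x ∈ T) ∨ (y ∈ T ∧ -y ∈ T)
  neg_one_notMem : -1 ∉ T

lemma exists_isPrimeCone (g : A) (T₀ : Subsemiring A) (h₀ : ∀ x, x * x ∈ T₀)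
    (hg : ∀ k : ℕ, -(g ^ (2 * k)) ∉ T₀) :
    ∃ T : Subsemiring A, T₀ ≤ T ∧ IsPrimeCone T ∧ ¬ (g ∈ T ∧ -g ∈ T) := by
  obtain ⟨T, hT₀, hT, hmax⟩ := zorn_le_nonempty₀ {T : Subsemiring A | ∀ k : ℕ, -(g ^ (2 * k)) ∉ T}
    (fun c hc hchain T hT => by
      refine ⟨sSup c, fun k hk => ?_, fun T hT => le_sSup hT⟩
      obtain ⟨T', hT', hk⟩ := (Subsemiring.mem_sSup_of_directedOn ⟨T, hT⟩ hchain.directedOn).1 hk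
      exact hc hT' k hk) T₀ hg
  have hsq : ∀ x, x * x ∈ T := fun x => hT₀ (h₀ x)
  have hpow : ∀ k : ℕ, g ^ (2 * k) ∈ T := fun k => by
    rw [two_mul, pow_add]; exact hsq _
  have key : ∀ a, a ∉ T → ∃ k : ℕ, ∃ s ∈ T, ∃ t ∈ T, -(g ^ (2 * k)) = s + a * t := by
    intro a ha
    by_contra! H
    refine ha (hmax (y := adjoinCone T hsq a) ?_ ?_ ?_)
    · rintro k ⟨s, hs, t, ht, h⟩
      exact H k s hs t ht h
    · exact fun x hx => ⟨x, hx, 0, zero_mem T, by ring⟩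
    · exact ⟨0, zero_mem T, 1, one_mem T, by ring⟩
  have total : ∀ x, x ∈ T ∨ -x ∈ T := by
    intro a
    by_contra! H
    obtain ⟨k, s, hs, t, ht, h⟩ := key _ H.1
    obtain ⟨l, s', hs', t', ht', h'⟩ := key _ H.2
    refine hT (k + l) ?_
    have : -(g ^ (2 * (k + l))) = a * a * (t * t') + (s * s' + g ^ (2 * k) * s' + s * g ^ (2 * l)) := by
      have e1 : s = -(g ^ (2 * k)) - a * t := by rw [h]; ring
      have e2 : s' = -(g ^ (2 * l)) + a * t' := by rw [h']; ring
      rw [e1, e2, mul_add, pow_add]; ring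
    rw [this]
    exact add_mem (mul_mem (hsq a) (mul_mem ht ht')) (add_mem (add_mem (mul_mem hs hs')
      (mul_mem (hpow k) hs')) (mul_mem hs (hpow l)))
  have aux : ∀ a b, -a ∉ T → -b ∉ T → a * b ∈ T → -(a * b) ∈ T → False := by
    intro a b ha hb hab hab'
    obtain ⟨k, s, hs, t, ht, h⟩ := key _ ha
    obtain ⟨l, s', hs', t', ht', h'⟩ := key _ hb
    refine hT (k + l) ?_
    have : -(g ^ (2 * (k + l))) = -(a * b) * (t * t') + (s * s' + g ^ (2 * k) * s' + s * g ^ (2 * l)) := by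
      have e1 : s = -(g ^ (2 * k)) + a * t := by rw [h]; ring
      have e2 : s' = -(g ^ (2 * l)) + b * t' := by rw [h']; ring
      rw [e1, e2, mul_add, pow_add]; ring
    rw [this]
    exact add_mem (mul_mem hab' (mul_mem ht ht')) (add_mem (add_mem (mul_mem hs hs')
      (mul_mem (hpow k) hs')) (mul_mem hs (hpow l)))
  refine ⟨T, hT₀, ⟨total, fun a b hab hab' => ?_, fun h => hT 0 (by simpa using h)⟩, fun h => hT 1 ?_⟩
  · by_contra! H
    by_cases ha : -a ∈ T <;> by_cases hb : -b ∈ T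
    · exact aux (-a) (-b) (by rw [neg_neg]; tauto) (by rw [neg_neg]; tauto)
        (by simpa using hab) (by simpa using hab')
    · exact aux (-a) b (by rw [neg_neg]; tauto) hb
        (by simpa using hab') (by simpa using hab)
    · exact aux a (-b) ha (by rw [neg_neg]; tauto)
        (by simpa using hab') (by simpa using hab)
    · exact aux a b ha hb hab hab'
  · have : -(g ^ (2 * 1)) = g * -g := by ring
    rw [this]
    exact mul_mem h.1 h.2

/-- The support of a prime cone. -/
def IsPrimeCone.support {T : Subsemiring A} (hT : IsPrimeCone T) : Ideal A where
  carrier := {x | x ∈ T ∧ -x ∈ T}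
  add_mem' := fun {a b} ha hb => ⟨add_mem ha.1 hb.1, by rw [neg_add]; exact add_mem ha.2 hb.2⟩
  zero_mem' := by simp
  smul_mem' := by
    intro c x hx
    rcases hT.total c with h | h
    · exact ⟨mul_mem h hx.1, by simpa using mul_mem h hx.2⟩
    · exact ⟨by simpa using mul_mem h hx.2, by simpa using mul_mem h hx.1⟩

lemma IsPrimeCone.mem_support {T : Subsemiring A} (hT : IsPrimeCone T) {x : A} :
    x ∈ hT.support ↔ x ∈ T ∧ -x ∈ T := Iff.rfl

lemma IsPrimeCone.isPrime_support {T : Subsemiring A} (hT : IsPrimeCone T) :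
    hT.support.IsPrime where
  ne_top' h := hT.neg_one_notMem ((Ideal.eq_top_iff_one _).1 h).2
  mem_or_mem' {x y} h := hT.prime x y h.1 h.2

/-- The nonnegative part of a linearly ordered subfield of `E`. -/
structure IsFieldCone {E : Type*} [Field E] (P : Set E) : Prop where
  one : 1 ∈ P
  add : ∀ x ∈ P, ∀ y ∈ P, x + y ∈ P
  mul : ∀ x ∈ P, ∀ y ∈ P, x * y ∈ P
  inv : ∀ x ∈ P, x⁻¹ ∈ P
  sub : ∀ x ∈ P, ∀ y ∈ P, x - y ∈ P ∨ y - x ∈ P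
  eq_zero : ∀ x ∈ P, -x ∈ P → x = 0

lemma IsFieldCone.exists_maximal {E : Type*} [Field E] {P₀ : Set E} (h₀ : IsFieldCone P₀) :
    ∃ P, P₀ ⊆ P ∧ Maximal IsFieldCone P := by
  refine zorn_le_nonempty₀ {P : Set E | IsFieldCone P} (fun c hc hchain P hP => ?_) P₀ h₀
  have two : ∀ x ∈ ⋃₀ c, ∀ y ∈ ⋃₀ c, ∃ Q ∈ c, x ∈ Q ∧ y ∈ Q := by
    rintro x ⟨Q, hQ, hx⟩ y ⟨Q', hQ', hy⟩
    rcases hchain.total hQ hQ' with h | h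
    · exact ⟨Q', hQ', h hx, hy⟩
    · exact ⟨Q, hQ, hx, h hy⟩
  refine ⟨⋃₀ c, ⟨⟨P, hP, (hc hP).one⟩, fun x hx y hy => ?_, fun x hx y hy => ?_, ?_,
    fun x hx y hy => ?_, fun x hx hy => ?_⟩, fun Q hQ => Set.subset_sUnion_of_mem hQ⟩
  · obtain ⟨Q, hQ, h1, h2⟩ := two x hx y hy
    exact ⟨Q, hQ, (hc hQ).add x h1 y h2⟩
  · obtain ⟨Q, hQ, h1, h2⟩ := two x hx y hy
    exact ⟨Q, hQ, (hc hQ).mul x h1 y h2⟩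
  · rintro x ⟨Q, hQ, hx⟩
    exact ⟨Q, hQ, (hc hQ).inv x hx⟩
  · obtain ⟨Q, hQ, h1, h2⟩ := two x hx y hy
    exact ((hc hQ).sub x h1 y h2).imp (fun h => ⟨Q, hQ, h⟩) (fun h => ⟨Q, hQ, h⟩)
  · obtain ⟨Q, hQ, h1, h2⟩ := two x hx _ hy
    exact (hc hQ).eq_zero x h1 h2

lemma IsPrimeCone.isFieldCone {T : Subsemiring A} (hT : IsPrimeCone T) {E : Type*} [Field E]
    (f : A →+* E) (hf : ∀ x, f x = 0 ↔ (x ∈ T ∧ -x ∈ T)) :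
    IsFieldCone {x : E | ∃ b p, f b ≠ 0 ∧ p ∈ T ∧ x * f b ^ 2 = f p} := by
  have hsq : ∀ x, x ^ 2 ∈ T := fun x => by
    rcases hT.total x with h | h
    · exact pow_mem h 2
    · simpa using pow_mem h 2
  refine ⟨⟨1, 1, by simp, one_mem T, by simp⟩, ?_, ?_, ?_, ?_, ?_⟩
  · rintro x ⟨b, p, hb, hp, hx⟩ y ⟨c, q, hc, hq, hy⟩
    refine ⟨b * c, c ^ 2 * p + b ^ 2 * q, by simp [hb, hc],
      add_mem (mul_mem (hsq c) hp) (mul_mem (hsq b) hq), ?_⟩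
    simp only [map_add, map_mul, map_pow, ← hx, ← hy]; ring
  · rintro x ⟨b, p, hb, hp, hx⟩ y ⟨c, q, hc, hq, hy⟩
    refine ⟨b * c, p * q, by simp [hb, hc], mul_mem hp hq, ?_⟩
    simp only [map_mul, ← hx, ← hy]; ring
  · rintro x ⟨b, p, hb, hp, hx⟩
    rcases eq_or_ne x 0 with rfl | hx0
    · exact ⟨b, p, hb, hp, by simpa using hx⟩
    · have hp0 : f p ≠ 0 := by rw [← hx]; simp [hx0, hb]
      refine ⟨p, b ^ 2 * p, hp0, mul_mem (hsq b) hp, ?_⟩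
      rw [map_mul, map_pow, ← hx]; field_simp
  · rintro x ⟨b, p, hb, hp, hx⟩ y ⟨c, q, hc, hq, hy⟩
    refine (hT.total (c ^ 2 * p - b ^ 2 * q)).imp (fun h => ⟨b * c, _, by simp [hb, hc], h, ?_⟩)
      (fun h => ⟨b * c, _, by simp [hb, hc], h, ?_⟩)
    all_goals
      simp only [map_sub, map_neg, map_mul, map_pow, ← hx, ← hy]; ring
  · rintro x ⟨b, p, hb, hp, hx⟩ ⟨c, q, hc, hq, hy⟩
    have h0 : f (c ^ 2 * p + b ^ 2 * q) = 0 := by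
      simp only [map_add, map_mul, map_pow, ← hx, ← hy]; ring
    have h1 := ((hf _).1 h0).2
    have h2 : f (c ^ 2 * p) = 0 := (hf _).2 ⟨mul_mem (hsq c) hp, by
      have := add_mem h1 (mul_mem (hsq b) hq)
      rwa [neg_add, neg_add_cancel_right] at this⟩
    rw [map_mul, ← hx] at h2
    simpa [hb, hc] using h2

end

section

variable {L : Type*} [Field L] [LinearOrder L] [IsStrictOrderedRing L]

variable (L) in
/-- Sums of squares of polynomials with nonnegative weights. -/
noncomputable def weightedSumSq : Subsemiring L[X] :=
  Submonoid.subsemiringClosure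
    { carrier := {p | ∃ c : L, 0 ≤ c ∧ ∃ h : L[X], p = C c * h ^ 2}
      mul_mem' := by
        rintro _ _ ⟨c, hc, h, rfl⟩ ⟨c', hc', h', rfl⟩
        exact ⟨c * c', mul_nonneg hc hc', h * h', by rw [C_mul]; ring⟩
      one_mem' := ⟨1, zero_le_one, 1, by simp⟩ }

lemma mem_weightedSumSq {p : L[X]} : p ∈ weightedSumSq L ↔
    p ∈ AddSubmonoid.closure {p | ∃ c : L, 0 ≤ c ∧ ∃ h : L[X], p = C c * h ^ 2} :=
  Submonoid.subsemiringClosure_mem _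

lemma C_mul_sq_mem_weightedSumSq {c : L} (hc : 0 ≤ c) (h : L[X]) :
    C c * h ^ 2 ∈ weightedSumSq L :=
  mem_weightedSumSq.2 (AddSubmonoid.subset_closure ⟨c, hc, h, rfl⟩)

lemma eval_nonneg_of_mem_weightedSumSq {p : L[X]} (hp : p ∈ weightedSumSq L) (a : L) :
    0 ≤ p.eval a := by
  rw [mem_weightedSumSq] at hp
  induction hp using AddSubmonoid.closure_induction with
  | mem x hx =>
    obtain ⟨c, hc, h, rfl⟩ := hx
    simp only [eval_mul, eval_C, eval_pow]
    positivity
  | zero => simp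
  | add x y _ _ hx hy => rw [eval_add]; exact add_nonneg hx hy

lemma exists_weightedSumSq_natDegree_le {q p : L[X]} (hq : 0 < q.natDegree)
    (hp : p ∈ weightedSumSq L) :
    ∃ p' ∈ weightedSumSq L, q ∣ p - p' ∧ p'.natDegree ≤ 2 * (q.natDegree - 1) := by
  rw [mem_weightedSumSq] at hp
  induction hp using AddSubmonoid.closure_induction with
  | mem x hx =>
    obtain ⟨c, hc, h, rfl⟩ := hx
    refine ⟨_, C_mul_sq_mem_weightedSumSq hc (h % q), ?_, ?_⟩
    · have : C c * h ^ 2 - C c * (h % q) ^ 2 = (h - h % q) * (C c * (h + h % q)) := by ring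
      rw [this]
      exact Dvd.dvd.mul_right ⟨h / q, by linear_combination -EuclideanDomain.div_add_mod h q⟩ _
    · have := natDegree_mod_lt h hq.ne'
      refine (natDegree_C_mul_le _ _).trans (natDegree_pow_le.trans ?_)
      omega
  | zero => exact ⟨0, zero_mem _, by simp⟩
  | add x y _ _ hx hy =>
    obtain ⟨x', hx', h1, h2⟩ := hx
    obtain ⟨y', hy', h3, h4⟩ := hy
    exact ⟨x' + y', add_mem hx' hy', by rw [add_sub_add_comm]; exact dvd_add h1 h3,
      natDegree_add_le_of_degree_le h2 h4⟩

lemma exists_irreducible_sign_change {F : L[X]} {a b : L} (h : F.eval a * F.eval b < 0) :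
    ∃ q, Irreducible q ∧ q ∣ F ∧ q.eval a * q.eval b < 0 := by
  induction F using WfDvdMonoid.induction_on_irreducible with
  | zero => simp at h
  | unit u hu =>
    obtain ⟨c, -, rfl⟩ := isUnit_iff.1 hu
    simp only [eval_C] at h
    exact absurd h (mul_self_nonneg c).not_gt
  | mul F i _ hi ih =>
    by_cases hneg : i.eval a * i.eval b < 0
    · exact ⟨i, hi, dvd_mul_right _ _, hneg⟩
    · rw [eval_mul, eval_mul, mul_mul_mul_comm] at h
      obtain ⟨q, h1, h2, h3⟩ := ih (by
        by_contra hF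
        exact absurd h (mul_nonneg (not_lt.1 hneg) (not_lt.1 hF)).not_gt)
      exact ⟨q, h1, h2.mul_left _, h3⟩

lemma not_dvd_one_add_weightedSumSq (d : ℕ) {a b : L} : ∀ {q : L[X]}, q.natDegree = d →
    Irreducible q → q.eval a * q.eval b < 0 → ∀ p ∈ weightedSumSq L, ¬ q ∣ 1 + p := by
  induction d using Nat.strong_induction_on with
  | _ d ih =>
  intro q hd hq hab p hp hdvd
  have hqd := hq.natDegree_pos
  obtain ⟨p', hp', h1, h2⟩ := exists_weightedSumSq_natDegree_le hqd hp
  obtain ⟨r, hr⟩ : q ∣ 1 + p' := by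
    have := dvd_sub hdvd h1
    rwa [show 1 + p - (p - p') = 1 + p' by ring] at this
  have hpos : ∀ c, 0 < q.eval c * r.eval c := fun c => by
    rw [← eval_mul, ← hr, eval_add, eval_one]
    linarith [eval_nonneg_of_mem_weightedSumSq hp' c]
  have hrab : r.eval a * r.eval b < 0 := by
    have := mul_pos (hpos a) (hpos b)
    rw [mul_mul_mul_comm, mul_comm] at this
    exact neg_of_mul_pos_left this hab.le
  have hr0 : r ≠ 0 := by rintro rfl; simp at hrab
  have hdeg : q.natDegree + r.natDegree ≤ 2 * (q.natDegree - 1) := by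
    rw [← natDegree_mul hq.ne_zero hr0, ← hr]
    exact natDegree_add_le_of_degree_le (by simp) h2
  obtain ⟨q', hq', h3, h4⟩ := exists_irreducible_sign_change hrab
  have := natDegree_le_of_dvd h3 hr0
  exact ih q'.natDegree (by omega) rfl hq' h4 p' hp' (hr ▸ h3.mul_left q)

/-- Polynomials congruent modulo `q` to a weighted sum of squares. -/
noncomputable def weightedSumSqMod (q : L[X]) : Subsemiring L[X] where
  carrier := {t | ∃ s ∈ weightedSumSq L, q ∣ t - s}
  mul_mem' := by
    rintro t t' ⟨s, hs, h⟩ ⟨s', hs', h'⟩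
    refine ⟨s * s', mul_mem hs hs', ?_⟩
    have : t * t' - s * s' = (t - s) * t' + (t' - s') * s := by ring
    rw [this]
    exact dvd_add (h.mul_right _) (h'.mul_right _)
  one_mem' := ⟨1, one_mem _, by simp⟩
  add_mem' := by
    rintro t t' ⟨s, hs, h⟩ ⟨s', hs', h'⟩
    exact ⟨s + s', add_mem hs hs', by rw [add_sub_add_comm]; exact dvd_add h h'⟩
  zero_mem' := ⟨0, zero_mem _, by simp⟩

lemma exists_isPrimeCone_polynomial {q : L[X]} (hq : Irreducible q) {a b : L}
    (hab : q.eval a * q.eval b < 0) :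
    ∃ T : Subsemiring L[X], IsPrimeCone T ∧ (∀ c, 0 ≤ c → C c ∈ T) ∧
      ∀ x, q ∣ x ↔ (x ∈ T ∧ -x ∈ T) := by
  obtain ⟨T, hT₀, hT, -⟩ := exists_isPrimeCone (1 : L[X]) (weightedSumSqMod q)
    (fun x => ⟨x * x, by simpa [pow_two] using C_mul_sq_mem_weightedSumSq zero_le_one x,
      by simp⟩) (by
      rintro k ⟨s, hs, h⟩
      refine not_dvd_one_add_weightedSumSq _ rfl hq hab s hs ?_
      rw [one_pow, ← neg_add', dvd_neg] at h
      exact h)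
  have hdvd : ∀ x, q ∣ x → (x ∈ T ∧ -x ∈ T) := fun x hx =>
    ⟨hT₀ ⟨0, zero_mem _, by simpa using hx⟩, hT₀ ⟨0, zero_mem _, by simpa using hx⟩⟩
  refine ⟨T, hT, fun c hc => hT₀ ⟨C c, ?_, by simp⟩, fun x => ⟨hdvd x, fun hx => ?_⟩⟩
  · simpa using C_mul_sq_mem_weightedSumSq hc (1 : L[X])
  · by_contra hndvd
    obtain ⟨u, v, huv⟩ := (hq.coprime_iff_not_dvd).2 hndvd
    have h1 : (1 : L[X]) ∈ hT.support := by
      rw [← huv]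
      exact add_mem (Ideal.mul_mem_left _ _ (hdvd q dvd_rfl)) (Ideal.mul_mem_left _ _ hx)
    exact hT.neg_one_notMem h1.2

end

namespace IsFieldCone

variable {E : Type*} [Field E] {P : Set E}

lemma zero (hP : IsFieldCone P) : (0 : E) ∈ P := by
  rcases hP.sub 1 hP.one 1 hP.one with h | h <;> simpa using h

/-- The field of differences of a field cone. -/
def subfield (hP : IsFieldCone P) : Subfield E where
  carrier := {x | x ∈ P ∨ -x ∈ P}
  mul_mem' := by
    rintro x y (hx | hx) (hy | hy)
    · exact .inl (hP.mul x hx y hy)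
    · exact .inr (by simpa using hP.mul x hx _ hy)
    · exact .inr (by simpa using hP.mul _ hx _ hy)
    · exact .inl (by simpa using hP.mul _ hx _ hy)
  one_mem' := .inl hP.one
  add_mem' := by
    rintro x y (hx | hx) (hy | hy)
    · exact .inl (hP.add x hx y hy)
    · simpa [sub_eq_add_neg, add_comm] using hP.sub x hx _ hy
    · simpa [sub_eq_add_neg, add_comm] using hP.sub y hy _ hx
    · exact .inr (by simpa [add_comm] using hP.add _ hx _ hy)
  zero_mem' := .inl hP.zero
  neg_mem' := by
    rintro x (hx | hx)
    · exact .inr (by simpa using hx)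
    · exact .inl hx
  inv_mem' := by
    rintro x (hx | hx)
    · exact .inl (hP.inv x hx)
    · exact .inr (by simpa [inv_neg] using hP.inv _ hx)

lemma mem_subfield (hP : IsFieldCone P) {x : E} : x ∈ hP.subfield ↔ x ∈ P ∨ -x ∈ P := Iff.rfl

/-- The order on the field of differences of a field cone. -/
@[reducible]
noncomputable def linearOrder (hP : IsFieldCone P) : LinearOrder hP.subfield where
  le x y := (y - x : E) ∈ P
  le_refl x := by simpa using hP.zero
  le_trans x y z hxy hyz := by simpa [add_comm] using hP.add _ hxy _ hyz
  le_antisymm x y hxy hyx := Subtype.ext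
    (sub_eq_zero.1 (hP.eq_zero _ hyx (by simpa using hxy)))
  le_total x y := by
    have := hP.mem_subfield.1 (y - x).2
    simpa using this
  toDecidableLE := Classical.decRel _

lemma isStrictOrderedRing (hP : IsFieldCone P) :
    @IsStrictOrderedRing hP.subfield _ hP.linearOrder.toPartialOrder := by
  let := hP.linearOrder
  have : IsOrderedAddMonoid hP.subfield :=
    { add_le_add_left := fun x y hxy z => show ((y + z : hP.subfield) - (x + z : hP.subfield) : E) ∈ P by
        simpa using show (y - x : E) ∈ P from hxy }
  have : ZeroLEOneClass hP.subfield := ⟨show _ ∈ P by simpa using hP.one⟩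
  have : IsOrderedRing hP.subfield := .of_mul_nonneg fun x y hx hy => show _ ∈ P by
    simpa using hP.mul _ (show _ ∈ P from hx) _ (show _ ∈ P from hy)
  exact IsOrderedRing.toIsStrictOrderedRing _

lemma polyIVT [IsAlgClosed E] (hP : IsFieldCone P) (hmax : Maximal IsFieldCone P) :
    @PolyIVT hP.subfield _ hP.linearOrder := by
  let := hP.linearOrder
  have := hP.isStrictOrderedRing
  intro F a b hab hF
  obtain ⟨q, hq, hqF, hqab⟩ := exists_irreducible_sign_change hF
  obtain ⟨T, hT, hTC, hqT⟩ := exists_isPrimeCone_polynomial hq hqab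
  obtain ⟨α, hα⟩ := IsAlgClosed.exists_eval₂_eq_zero hP.subfield.subtype q
    hq.degree_pos.ne'
  let f := eval₂RingHom hP.subfield.subtype α
  have hf : ∀ x, f x = 0 ↔ (x ∈ T ∧ -x ∈ T) := fun x => by
    rw [← hqT]
    refine ⟨fun hx => ?_, ?_⟩
    · by_contra hndvd
      obtain ⟨u, v, huv⟩ := (hq.coprime_iff_not_dvd).2 hndvd
      have := congrArg f huv
      simp [hx, show f q = 0 from hα] at this
    · rintro ⟨r, rfl⟩
      simp [show f q = 0 from hα]
  have hle := hmax.2 (hT.isFieldCone f hf) fun x hx => ⟨1, C ⟨x, .inl hx⟩, by simp,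
    hTC _ (show _ ∈ P by simpa using hx), by simp [f]⟩
  have hαP : α ∈ hP.subfield := (hT.total X).imp
    (fun h => hle ⟨1, _, by simp, h, by simp [f]⟩) (fun h => hle ⟨1, _, by simp, h, by simp [f]⟩)
  let c : hP.subfield := ⟨α, hαP⟩
  have hc : q.eval c = 0 := by
    refine hP.subfield.subtype.injective ?_
    rw [map_zero, ← hα]
    exact hom_eval₂ ..
  obtain ⟨r, hr⟩ := dvd_iff_isRoot.2 hc
  obtain ⟨e, -, rfl⟩ := isUnit_iff.1
    ((hq.isUnit_or_isUnit hr).resolve_left (not_isUnit_X_sub_C c))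
  rw [hr] at hqab
  simp only [eval_mul, eval_sub, eval_X, eval_C] at hqab
  have hneg : (a - c) * (b - c) < 0 := by
    rw [mul_mul_mul_comm] at hqab
    exact neg_of_mul_neg_left hqab (mul_self_nonneg e)
  refine ⟨c, ?_, ?_, eval_eq_zero_of_dvd_of_eval_eq_zero hqF hc⟩
  · by_contra! h
    exact absurd hneg (mul_nonneg (sub_nonneg.2 h) (sub_nonneg.2 (h.trans hab.le))).not_gt
  · by_contra! h
    exact absurd hneg (mul_nonneg_of_nonpos_of_nonpos (sub_nonpos.2 (hab.le.trans h))
      (sub_nonpos.2 h)).not_gt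

end IsFieldCone

/-- Elements congruent modulo `I` to a sum of squares. -/
def sumSqMod {A : Type*} [CommRing A] (I : Ideal A) : Subsemiring A where
  carrier := {t | ∃ s, IsSumSq s ∧ t - s ∈ I}
  mul_mem' := by
    rintro t t' ⟨s, hs, h⟩ ⟨s', hs', h'⟩
    refine ⟨s * s', hs.mul hs', ?_⟩
    have : t * t' - s * s' = t' * (t - s) + s * (t' - s') := by ring
    rw [this]
    exact add_mem (I.mul_mem_left _ h) (I.mul_mem_left _ h')
  one_mem' := ⟨1, .one, by simp⟩
  add_mem' := by
    rintro t t' ⟨s, hs, h⟩ ⟨s', hs', h'⟩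
    exact ⟨s + s', hs.add hs', by rw [add_sub_add_comm]; exact add_mem h h'⟩
  zero_mem' := ⟨0, .zero, by simp⟩

/-- The real Nullstellensatz. -/
theorem exists_neg_pow_sub_sumSq_mem {n : ℕ} {I : Ideal (MvPolynomial (Fin n) ℝ)}
    {g : MvPolynomial (Fin n) ℝ}
    (hg : ∀ x, (∀ p ∈ I, MvPolynomial.eval x p = 0) → MvPolynomial.eval x g = 0) :
    ∃ (k : ℕ) (s : MvPolynomial (Fin n) ℝ), IsSumSq s ∧ -(g ^ (2 * k)) - s ∈ I := by
  by_contra hcon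
  obtain ⟨T, hT₀, hT, hgT⟩ := exists_isPrimeCone g (sumSqMod I)
    (fun x => ⟨x * x, .mul_self x, by simp⟩) (fun k h => hcon ⟨k, h⟩)
  have := hT.isPrime_support
  let f : MvPolynomial (Fin n) ℝ →+*
      AlgebraicClosure (FractionRing (MvPolynomial (Fin n) ℝ ⧸ hT.support)) :=
    (algebraMap (FractionRing (MvPolynomial (Fin n) ℝ ⧸ hT.support)) _).comp
      ((algebraMap _ _).comp (Ideal.Quotient.mk hT.support))
  have hf : ∀ x, f x = 0 ↔ (x ∈ T ∧ -x ∈ T) := fun x => by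
    rw [← hT.mem_support, ← Ideal.Quotient.eq_zero_iff_mem, RingHom.comp_apply,
      map_eq_zero, RingHom.comp_apply, FaithfulSMul.algebraMap_eq_zero_iff]
  obtain ⟨P, hle, hmax⟩ := (hT.isFieldCone f hf).exists_maximal
  have hP := hmax.1
  let := hP.linearOrder
  have := hP.isStrictOrderedRing
  have hfP : ∀ a, f a ∈ hP.subfield := fun a => (hT.total a).imp
    (fun h => hle ⟨1, _, by simp, h, by simp⟩) (fun h => hle ⟨1, _, by simp, h, by simp⟩)
  let f' := f.codRestrict hP.subfield hfP
  have hf' : ∀ p : MvPolynomial (Fin n) ℝ,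
      p.eval₂ (f'.comp MvPolynomial.C) (fun j => f' (MvPolynomial.X j)) = f' p := fun p => by
    rw [← MvPolynomial.coe_eval₂Hom]
    exact RingHom.congr_fun (MvPolynomial.ringHom_ext (by simp) (by simp)) p
  have hf'0 : ∀ p, f' p = 0 ↔ (p ∈ T ∧ -p ∈ T) := fun p => by
    rw [← hf, ← ZeroMemClass.coe_eq_zero]; rfl
  obtain ⟨s, hs⟩ := IsNoetherian.noetherian I
  obtain ⟨x, hx, hgx⟩ := exists_real_point (hP.polyIVT hmax) (φ := f'.comp MvPolynomial.C) s g
    (fun j => f' (MvPolynomial.X j)) (fun p hp => by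
      rw [hf', hf'0]
      have hpI : p ∈ I := hs ▸ Submodule.subset_span hp
      exact ⟨hT₀ ⟨0, .zero, by simpa⟩, hT₀ ⟨0, .zero, by simpa⟩⟩)
    (by rwa [hf', Ne, hf'0])
  refine hgx (hg x fun p hp => ?_)
  have : I ≤ RingHom.ker (MvPolynomial.eval x) := by
    rw [← hs]
    exact Submodule.span_le.2 hx
  exact this hp

section

variable {A : Type*} [CommRing A] [Algebra ℝ A] {Λ : A →ₗ[ℝ] ℝ}

lemma apply_eq_zero_of_apply_sq_eq_zero (hΛ : ∀ p, 0 ≤ Λ (p ^ 2)) {p : A} (hp : Λ (p ^ 2) = 0) :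
    Λ p = 0 := by
  by_contra h
  have key : ∀ t : ℝ, 0 ≤ Λ 1 + 2 * t * Λ p := fun t => by
    have h1 : (1 + t • p) ^ 2 = 1 + (2 * t) • p + t ^ 2 • p ^ 2 := by
      simp only [Algebra.smul_def, map_mul, map_pow, map_ofNat]; ring
    have h2 := hΛ (1 + t • p)
    rw [h1] at h2
    simpa [hp] using h2
  have := key (-(Λ 1 + 1) / (2 * Λ p))
  have h3 : 2 * (-(Λ 1 + 1) / (2 * Λ p)) * Λ p = -(Λ 1 + 1) := by field_simp
  linarith

lemma apply_eq_zero_of_apply_pow_eq_zero (hΛ : ∀ p, 0 ≤ Λ (p ^ 2)) {p : A} (r : ℕ)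
    (hp : Λ (p ^ 2 ^ r) = 0) : Λ p = 0 := by
  induction r with
  | zero => simpa using hp
  | succ r ih =>
    rw [pow_succ, pow_mul] at hp
    exact ih (apply_eq_zero_of_apply_sq_eq_zero hΛ hp)

lemma apply_sq_mul_nonneg_of_isSumSq (hΛ : ∀ p, 0 ≤ Λ (p ^ 2)) (h : A) {s : A} (hs : IsSumSq s) :
    0 ≤ Λ (h ^ 2 * s) := by
  induction hs with
  | zero => simp
  | sq_add a _ ih =>
    rw [mul_add, map_add, ← pow_two, ← mul_pow]
    exact add_nonneg (hΛ _) ih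

end

end

theorem stmt_8 (n : ℕ) (hn : 0 < n) (I : Ideal (MvPolynomial (Fin n) ℝ))
    (Λ : MvPolynomial (Fin n) ℝ →ₗ[ℝ] ℝ) (hΛ : IsPosDefR Λ) :
    VanishesOnR Λ I ↔ VanishesOnR Λ (vanishingIdealR (zeroSetR I)) := by
  refine ⟨fun h g hg => ?_, fun h p hp => h p fun x hx => hx p hp⟩
  obtain ⟨k, s, hs, hmem⟩ := exists_neg_pow_sub_sumSq_mem (I := I) (g := g) hg
  obtain ⟨j, hj⟩ : ∃ j, 2 ^ (k + 1) = 2 * k + 2 * j := by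
    have := k.lt_two_pow_self
    exact ⟨2 ^ k - k, by rw [pow_succ]; omega⟩
  refine apply_eq_zero_of_apply_pow_eq_zero hΛ (k + 1) (le_antisymm ?_ ?_)
  · have h1 := h _ (I.mul_mem_left ((g ^ j) ^ 2) hmem)
    have h2 : (g ^ j) ^ 2 * (-(g ^ (2 * k)) - s) = -(g ^ 2 ^ (k + 1)) - (g ^ j) ^ 2 * s := by
      rw [hj]; ring
    rw [h2, map_sub, map_neg] at h1
    linarith [apply_sq_mul_nonneg_of_isSumSq hΛ (g ^ j) hs]
  · rw [pow_succ, pow_mul]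
    exact hΛ _
end

section
/- Let I be a *-ideal of ℂ[X₁,…,Xₙ] and let Λ : ℂ[X₁,…,Xₙ] → ℂ be a positive definite linear functional. Then Λ vanishes on I if and only if Λ vanishes on I_ℂ(Z(I)). -/
open MeasureTheory
open scoped ComplexOrder

noncomputable def evalC {n : ℕ} (P : MvPolynomial (Fin n) ℂ) (x : Fin n → ℝ) : ℂ :=
  MvPolynomial.aeval (fun i => (x i : ℂ)) P

noncomputable def starC {n : ℕ} (P : MvPolynomial (Fin n) ℂ) : MvPolynomial (Fin n) ℂ :=
  MvPolynomial.map (starRingEnd ℂ) P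

def IsPosDefC {n : ℕ} (Λ : MvPolynomial (Fin n) ℂ →ₗ[ℂ] ℂ) : Prop :=
  ∀ P : MvPolynomial (Fin n) ℂ, 0 ≤ Λ (starC P * P)

def IsMomentC {n : ℕ} (Λ : MvPolynomial (Fin n) ℂ →ₗ[ℂ] ℂ) : Prop :=
  ∃ μ : Measure (Fin n → ℝ),
    (∀ Q : MvPolynomial (Fin n) ℂ, Integrable (fun x => evalC Q x) μ) ∧
    (∀ Q : MvPolynomial (Fin n) ℂ, Λ Q = ∫ x, evalC Q x ∂μ)

noncomputable def vanishingIdealC {n : ℕ} (Z : Set (Fin n → ℝ)) :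
    Ideal (MvPolynomial (Fin n) ℂ) where
  carrier := {P | ∀ x ∈ Z, evalC P x = 0}
  add_mem' := by
    intro a b ha hb x hx
    simp only [Set.mem_setOf_eq, evalC, map_add] at *
    rw [ha x hx, hb x hx, add_zero]
  zero_mem' := by
    intro x hx
    simp [evalC]
  smul_mem' := by
    intro c a ha x hx
    simp only [Set.mem_setOf_eq, evalC, smul_eq_mul, map_mul] at *
    rw [ha x hx, mul_zero]

def zeroSetC {n : ℕ} (I : Ideal (MvPolynomial (Fin n) ℂ)) : Set (Fin n → ℝ) :=
  {x | ∀ P ∈ I, evalC P x = 0}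

def zSetC {n : ℕ} (P : MvPolynomial (Fin n) ℂ) : Set (Fin n → ℝ) :=
  {x | evalC P x = 0}

def VanishesOnC {n : ℕ} (Λ : MvPolynomial (Fin n) ℂ →ₗ[ℂ] ℂ)
    (I : Ideal (MvPolynomial (Fin n) ℂ)) : Prop :=
  ∀ P ∈ I, Λ P = 0

def nSetC {n : ℕ} (Λ : MvPolynomial (Fin n) ℂ →ₗ[ℂ] ℂ) : Set (MvPolynomial (Fin n) ℂ) :=
  {P | Λ (starC P * P) = 0}

def IsTypeAC {n : ℕ} (P : MvPolynomial (Fin n) ℂ) : Prop :=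
  ∀ Λ : MvPolynomial (Fin n) ℂ →ₗ[ℂ] ℂ,
    IsPosDefC Λ → VanishesOnC Λ (Ideal.span {P}) → IsMomentC Λ

section RealNullstellensatz

open Polynomial

def PolynomialIVT (R : Type*) [Field R] [LinearOrder R] : Prop :=
  ∀ (f : R[X]) (a b : R), a < b → f.eval a * f.eval b < 0 → ∃ c ∈ Set.Ioo a b, f.eval c = 0

section IVT

variable {R : Type*} [Field R] [LinearOrder R] [IsStrictOrderedRing R]

theorem PolynomialIVT.exists_derivative_eval_eq_zero_of_consecutive_roots (hR : PolynomialIVT R)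
    {f : R[X]} (hf : f ≠ 0) {a b : R} (hab : a < b) (ha : f.eval a = 0) (hb : f.eval b = 0)
    (hne : ∀ c ∈ Set.Ioo a b, f.eval c ≠ 0) :
    ∃ c ∈ Set.Ioo a b, f.derivative.eval c = 0 := by
  obtain ⟨g, hg, hga⟩ := exists_eq_pow_rootMultiplicity_mul_and_not_dvd f hf a
  obtain ⟨m, hm⟩ : ∃ m, f.rootMultiplicity a = m + 1 :=
    Nat.exists_eq_succ_of_ne_zero ((rootMultiplicity_pos hf).2 ha).ne'
  have hg0 : g ≠ 0 := by rintro rfl; simp at hga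
  have hab' : b - a ≠ 0 := (sub_pos.2 hab).ne'
  have hgb : g.eval b = 0 := by
    rw [hg] at hb
    simpa [hab'] using hb
  obtain ⟨h, hh, hhb⟩ := exists_eq_pow_rootMultiplicity_mul_and_not_dvd g hg0 b
  obtain ⟨k, hk⟩ : ∃ k, g.rootMultiplicity b = k + 1 :=
    Nat.exists_eq_succ_of_ne_zero ((rootMultiplicity_pos hg0).2 hgb).ne'
  rw [hm] at hg
  rw [hk] at hh
  rw [dvd_iff_isRoot, IsRoot] at hga hhb
  have hha : h.eval a ≠ 0 := by
    intro h0
    apply hga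
    rw [hh]
    simp [h0]
  have hhpos : 0 < h.eval a * h.eval b := by
    by_contra hcon
    obtain ⟨c, hc, hc0⟩ := hR h a b hab (lt_of_le_of_ne (not_lt.1 hcon) (mul_ne_zero hha hhb))
    apply hne c hc
    rw [hg, hh]
    simp [hc0]
  obtain ⟨c, hc, hc0⟩ := hR
    ((((m : R[X]) + 1) * (X - C b) + ((k : R[X]) + 1) * (X - C a)) * h
      + (X - C a) * (X - C b) * derivative h) a b hab (by
    simp only [eval_add, eval_mul, eval_natCast, eval_one, eval_sub, eval_X, eval_C]
    have h1 : (0 : R) < (m + 1) * (k + 1) := by positivity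
    have h2 : 0 < (b - a) * (b - a) := by have := sub_pos.2 hab; positivity
    have := mul_pos (mul_pos h1 h2) hhpos
    nlinarith)
  refine ⟨c, hc, ?_⟩
  have : f.derivative = (X - C a) ^ m * (X - C b) ^ k *
      ((((m : R[X]) + 1) * (X - C b) + ((k : R[X]) + 1) * (X - C a)) * h
      + (X - C a) * (X - C b) * derivative h) := by
    rw [hg, hh]
    simp only [derivative_mul, derivative_pow, derivative_sub, derivative_X, derivative_C]
    simp
    ring
  rw [this, eval_mul, hc0, mul_zero]

theorem PolynomialIVT.exists_derivative_eval_eq_zero (hR : PolynomialIVT R) (f : R[X]) {a b : R}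
    (hab : a < b) (h : f.eval a = f.eval b) : ∃ c ∈ Set.Ioo a b, f.derivative.eval c = 0 := by
  obtain ⟨g, hg⟩ : ∃ g, g = f - C (f.eval a) := ⟨_, rfl⟩
  have hd : f.derivative = g.derivative := by simp [hg]
  rw [hd]
  by_cases hg0 : g = 0
  · obtain ⟨c, hc⟩ := exists_between hab
    exact ⟨c, hc, by simp [hg0]⟩
  have hga : g.eval a = 0 := by simp [hg]
  have hgb : g.eval b = 0 := by simp [hg, h]
  have hne : (g.roots.toFinset.filter (a < ·)).Nonempty := ⟨b, by simp [hg0, hgb, hab]⟩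
  have hmem := Finset.min'_mem _ hne
  have hmin := Finset.min'_le (g.roots.toFinset.filter (a < ·))
  set b' := (g.roots.toFinset.filter (a < ·)).min' hne
  simp only [Finset.mem_filter, Multiset.mem_toFinset, mem_roots hg0, IsRoot] at hmem hmin
  obtain ⟨c, hc, hc0⟩ := hR.exists_derivative_eval_eq_zero_of_consecutive_roots hg0 hmem.2 hga
    hmem.1 (fun c hc h0 => absurd (hmin c ⟨h0, hc.1⟩) (not_le.2 hc.2))
  exact ⟨c, ⟨hc.1, hc.2.trans_le (hmin b ⟨hgb, hab⟩)⟩, hc0⟩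

theorem PolynomialIVT.exists_eval_eq (hR : PolynomialIVT R) (f : R[X]) {a b v : R} (hab : a < b)
    (hv : f.eval a < v ∧ v < f.eval b ∨ f.eval b < v ∧ v < f.eval a) :
    ∃ c ∈ Set.Ioo a b, f.eval c = v := by
  obtain ⟨c, hc, hc0⟩ := hR (f - C v) a b hab (by
    simp only [eval_sub, eval_C]
    rcases hv with hv | hv
    · exact mul_neg_of_neg_of_pos (sub_neg.2 hv.1) (sub_pos.2 hv.2)
    · exact mul_neg_of_pos_of_neg (sub_pos.2 hv.2) (sub_neg.2 hv.1))
  exact ⟨c, hc, by simpa [sub_eq_zero] using hc0⟩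

theorem PolynomialIVT.eval_strictly_between (hR : PolynomialIVT R) (f : R[X]) {a b x : R}
    (hx : x ∈ Set.Ioo a b) (hne : ∀ c ∈ Set.Ioo a b, f.derivative.eval c ≠ 0) :
    f.eval a < f.eval x ∧ f.eval x < f.eval b ∨ f.eval b < f.eval x ∧ f.eval x < f.eval a := by
  have hinj : ∀ (f : R[X]), (∀ c ∈ Set.Ioo a b, f.derivative.eval c ≠ 0) →
      ∀ y z : R, a ≤ y → y < z → z ≤ b → f.eval y ≠ f.eval z := by
    intro f hne y z hy hyz hz h
    obtain ⟨c, hc, hc0⟩ := hR.exists_derivative_eval_eq_zero f hyz h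
    exact hne c ⟨hy.trans_lt hc.1, hc.2.trans_le hz⟩ hc0
  have key : ∀ (f : R[X]), (∀ c ∈ Set.Ioo a b, f.derivative.eval c ≠ 0) →
      f.eval a < f.eval b → f.eval a < f.eval x ∧ f.eval x < f.eval b := by
    intro f hne h
    have h1 := hinj f hne a x le_rfl hx.1 hx.2.le
    have h2 := hinj f hne x b hx.1.le hx.2 le_rfl
    constructor
    · by_contra hcon
      obtain ⟨c, hc, hc0⟩ := hR.exists_eval_eq f hx.2
        (.inl ⟨lt_of_le_of_ne (not_lt.1 hcon) h1.symm, h⟩)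
      exact hinj f hne a c le_rfl (hx.1.trans hc.1) hc.2.le hc0.symm
    · by_contra hcon
      obtain ⟨c, hc, hc0⟩ := hR.exists_eval_eq f hx.1
        (.inl ⟨h, lt_of_le_of_ne (not_lt.1 hcon) h2.symm⟩)
      exact hinj f hne c b hc.1.le (hc.2.trans hx.2) le_rfl hc0
  rcases lt_or_gt_of_ne (hinj f hne a b le_rfl (hx.1.trans hx.2) le_rfl) with h | h
  · exact .inl (key f hne h)
  · right
    simpa [and_comm] using key (-f) (by simpa using hne) (by simpa using h)

theorem PolynomialIVT.sign_eval_eq (hR : PolynomialIVT R) (f : R[X]) {a b : R}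
    (hne : ∀ c ∈ Set.uIcc a b, f.eval c ≠ 0) :
    SignType.sign (f.eval a) = SignType.sign (f.eval b) := by
  wlog hab : a ≤ b generalizing a b
  · exact (this (by rwa [Set.uIcc_comm]) (le_of_not_ge hab)).symm
  rw [Set.uIcc_of_le hab] at hne
  rcases hab.eq_or_lt with rfl | hab
  · rfl
  have ha := hne a ⟨le_rfl, hab.le⟩
  have hb := hne b ⟨hab.le, le_rfl⟩
  by_contra hs
  obtain ⟨c, hc, hc0⟩ := hR f a b hab (by
    rcases lt_or_gt_of_ne ha with h1 | h1 <;> rcases lt_or_gt_of_ne hb with h2 | h2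
    · simp [sign_neg h1, sign_neg h2] at hs
    · exact mul_neg_of_neg_of_pos h1 h2
    · exact mul_neg_of_pos_of_neg h1 h2
    · simp [sign_pos h1, sign_pos h2] at hs)
  exact hne c (Set.Ioo_subset_Icc_self hc) hc0

theorem Polynomial.exists_forall_ge_le_eval (f : R[X]) (hf : 0 < f.leadingCoeff) :
    ∃ B : R, ∃ c > 0, ∀ x ≥ B, c ≤ f.eval x := by
  induction hn : f.natDegree generalizing f with
  | zero =>
    obtain ⟨a, rfl⟩ := natDegree_eq_zero.1 hn
    exact ⟨0, a, by simpa using hf, by simp⟩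
  | succ n ih =>
    have hd : f.divX.natDegree = n := by rw [natDegree_divX_eq_natDegree_tsub_one, hn]; rfl
    obtain ⟨B, c, hc, hB⟩ := ih f.divX (by
      rwa [leadingCoeff, hd, coeff_divX, ← hn]) hd
    refine ⟨max 0 (max B ((1 - f.coeff 0) / c)), 1, one_pos, fun x hx => ?_⟩
    simp only [ge_iff_le, max_le_iff] at hx
    rw [← f.divX_mul_X_add]
    simp only [eval_add, eval_mul, eval_X, eval_C]
    have h1 := mul_le_mul_of_nonneg_right (hB x hx.2.1) hx.1
    have h2 := (div_le_iff₀ hc).1 hx.2.2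
    linarith

theorem Polynomial.exists_forall_ge_sign_eval_eq (f : R[X]) :
    ∃ B : R, ∀ x ≥ B, SignType.sign (f.eval x) = SignType.sign f.leadingCoeff := by
  rcases lt_trichotomy f.leadingCoeff 0 with h | h | h
  · obtain ⟨B, c, hc, hB⟩ := (-f).exists_forall_ge_le_eval (by simpa using h)
    refine ⟨B, fun x hx => ?_⟩
    have := hB x hx
    rw [eval_neg] at this
    rw [sign_neg h, sign_neg (by linarith)]
  · exact ⟨0, by simp [leadingCoeff_eq_zero.1 h]⟩
  · obtain ⟨B, c, hc, hB⟩ := f.exists_forall_ge_le_eval h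
    refine ⟨B, fun x hx => ?_⟩
    have := hB x hx
    rw [sign_pos h, sign_pos (by linarith)]

theorem Polynomial.exists_forall_le_sign_eval_eq (f : R[X]) :
    ∃ B : R, ∀ x ≤ B, SignType.sign (f.eval x) =
      SignType.sign ((-1) ^ f.natDegree * f.leadingCoeff) := by
  obtain ⟨B, hB⟩ := (f.comp (-X)).exists_forall_ge_sign_eval_eq
  refine ⟨-B, fun x hx => ?_⟩
  have := hB (-x) (le_neg_of_le_neg hx)
  rw [leadingCoeff_comp (by simp)] at this
  simpa [mul_comm] using this

end IVT

theorem exists_strictly_between_sign_eq {R R' : Type*} [Field R] [LinearOrder R]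
    [IsStrictOrderedRing R] [Field R'] [LinearOrder R'] [IsStrictOrderedRing R']
    {a b x : R} {a' b' : R'} (hx : a < x ∧ x < b ∨ b < x ∧ x < a) (hne : a' ≠ b')
    (ha : SignType.sign a = SignType.sign a') (hb : SignType.sign b = SignType.sign b') :
    ∃ v, (a' < v ∧ v < b' ∨ b' < v ∧ v < a') ∧ SignType.sign x = SignType.sign v := by
  wlog hab : a' < b' generalizing a b a' b'
  · obtain ⟨v, hv, hs⟩ := this hx.symm hne.symm hb ha
      (lt_of_le_of_ne (not_lt.1 hab) hne.symm)
    exact ⟨v, hv.symm, hs⟩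
  have hb1 : 0 < b → 0 < b' := fun h => by rwa [sign_pos h, eq_comm, sign_eq_one_iff] at hb
  have ha1 : 0 < a → 0 < a' := fun h => by rwa [sign_pos h, eq_comm, sign_eq_one_iff] at ha
  have hb2 : b < 0 → b' < 0 := fun h => by rwa [sign_neg h, eq_comm, sign_eq_neg_one_iff] at hb
  have ha2 : a < 0 → a' < 0 := fun h => by rwa [sign_neg h, eq_comm, sign_eq_neg_one_iff] at ha
  rcases lt_trichotomy x 0 with h | rfl | h
  · have : a' < 0 := by
      rcases hx with hx | hx
      · exact ha2 (hx.1.trans h)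
      · exact hab.trans (hb2 (hx.1.trans h))
    obtain ⟨v, hv⟩ := exists_between (lt_min hab this)
    rw [lt_min_iff] at hv
    exact ⟨v, .inl ⟨hv.1, hv.2.1⟩, by rw [sign_neg h, sign_neg hv.2.2]⟩
  · refine ⟨0, ?_, by simp⟩
    rcases hx with hx | hx
    · exact .inl ⟨ha2 hx.1, hb1 hx.2⟩
    · exact .inr ⟨hb2 hx.1, ha1 hx.2⟩
  · have : 0 < b' := by
      rcases hx with hx | hx
      · exact hb1 (h.trans hx.2)
      · exact (ha1 (h.trans hx.2)).trans hab
    obtain ⟨v, hv⟩ := exists_between (max_lt hab this)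
    rw [max_lt_iff] at hv
    exact ⟨v, .inl ⟨hv.1.1, hv.2⟩, by rw [sign_pos h, sign_pos hv.1.2]⟩

theorem polynomialIVT_real : PolynomialIVT ℝ := by
  intro f a b hab h
  rcases mul_neg_iff.1 h with ⟨h1, h2⟩ | ⟨h1, h2⟩
  · exact intermediate_value_Ioo' hab.le f.continuous.continuousOn ⟨h2, h1⟩
  · exact intermediate_value_Ioo hab.le f.continuous.continuousOn ⟨h1, h2⟩

def SignMatch {C R R' : Type*} [CommRing C] [Field R] [LinearOrder R] [Field R'] [LinearOrder R']
    (φ : C →+* R) (φ' : C →+* R') (F : Finset C[X]) : Prop :=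
  ∀ S : Finset R, ∃ σ : R → R', StrictMonoOn σ S ∧ ∀ f ∈ F, ∀ s ∈ S,
    SignType.sign ((f.map φ).eval s) = SignType.sign ((f.map φ').eval (σ s))

theorem sign_eq_zero_congr {R R' : Type*} [Zero R] [LinearOrder R] [Zero R'] [LinearOrder R']
    {a : R} {b : R'} (h : SignType.sign a = SignType.sign b) : a = 0 ↔ b = 0 := by
  rw [← sign_eq_zero_iff, h, sign_eq_zero_iff]

section SignMatch

variable {C R R' : Type*} [CommRing C] [Field R] [LinearOrder R] [Field R'] [LinearOrder R']

theorem Finset.exists_strictMonoOn {R : Type*} [LinearOrder R] (R' : Type*) [Field R']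
    [LinearOrder R'] [IsStrictOrderedRing R'] (S : Finset R) : ∃ σ : R → R', StrictMonoOn σ S := by
  refine ⟨fun s => ((S.filter (· < s)).card : R'), fun s hs t ht hst => ?_⟩
  simp only [Nat.cast_lt]
  apply Finset.card_lt_card
  rw [Finset.ssubset_iff_of_subset]
  · exact ⟨s, by simpa using ⟨hs, hst⟩, by simp⟩
  · intro u hu
    simp only [Finset.mem_filter] at hu ⊢
    exact ⟨hu.1, hu.2.trans hst⟩

open Classical in
noncomputable def Polynomial.rootsOfNonzero (φ : C →+* R) (E : Finset C[X]) : Finset R :=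
  E.biUnion fun g => (g.map φ).roots.toFinset

theorem Polynomial.mem_rootsOfNonzero {φ : C →+* R} {E : Finset C[X]} {z : R} :
    z ∈ rootsOfNonzero φ E ↔ ∃ g ∈ E, g.map φ ≠ 0 ∧ (g.map φ).eval z = 0 := by
  classical
  simp only [rootsOfNonzero, Finset.mem_biUnion, Multiset.mem_toFinset]
  refine exists_congr fun g => and_congr_right fun _ => ?_
  rw [mem_roots']
  rfl

theorem Polynomial.map_ne_zero_congr {φ : C →+* R} {φ' : C →+* R'} {g : C[X]}
    (h : ∀ i, SignType.sign (φ (g.coeff i)) = SignType.sign (φ' (g.coeff i))) :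
    g.map φ ≠ 0 ↔ g.map φ' ≠ 0 := by
  refine not_congr ?_
  simp only [Polynomial.ext_iff, coeff_map, coeff_zero]
  exact forall_congr' fun i => sign_eq_zero_congr (h i)

theorem Polynomial.natDegree_map_congr {φ : C →+* R} {φ' : C →+* R'} {g : C[X]}
    (h : ∀ i, SignType.sign (φ (g.coeff i)) = SignType.sign (φ' (g.coeff i))) :
    (g.map φ).natDegree = (g.map φ').natDegree := by
  have : (g.map φ).support = (g.map φ').support := by
    ext i
    simp only [mem_support_iff, coeff_map]
    exact not_congr (sign_eq_zero_congr (h i))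
  simp only [natDegree, degree, this]

theorem Polynomial.mem_rootsOfNonzero_of_sign_eq {φ : C →+* R} {φ' : C →+* R'} {E : Finset C[X]}
    (hE : ∀ g ∈ E, ∀ i, SignType.sign (φ (g.coeff i)) = SignType.sign (φ' (g.coeff i)))
    {z : R} {z' : R'} (h : ∀ g ∈ E, SignType.sign ((g.map φ).eval z) =
      SignType.sign ((g.map φ').eval z')) :
    z ∈ rootsOfNonzero φ E ↔ z' ∈ rootsOfNonzero φ' E := by
  rw [mem_rootsOfNonzero, mem_rootsOfNonzero]
  refine exists_congr fun g => and_congr_right fun hg => ?_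
  rw [map_ne_zero_congr (hE g hg), sign_eq_zero_congr (h g hg)]

variable [IsStrictOrderedRing R]

theorem Polynomial.exists_lt_sign_eval_eq (f : R[X]) (S : Finset R) :
    ∃ a, (∀ x ∈ S, a < x) ∧ SignType.sign (f.eval a) =
      SignType.sign ((-1) ^ f.natDegree * f.leadingCoeff) := by
  classical
  obtain ⟨B, hB⟩ := f.exists_forall_le_sign_eval_eq
  obtain ⟨M, hM⟩ := (insert B S).finite_toSet.bddBelow
  refine ⟨M - 1, fun x hx => ?_, hB _ ?_⟩
  · linarith [hM (Finset.mem_insert_of_mem hx)]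
  · linarith [hM (Finset.mem_insert_self B S)]

theorem Polynomial.exists_gt_sign_eval_eq (f : R[X]) (S : Finset R) :
    ∃ b, (∀ x ∈ S, x < b) ∧ SignType.sign (f.eval b) = SignType.sign f.leadingCoeff := by
  classical
  obtain ⟨B, hB⟩ := f.exists_forall_ge_sign_eval_eq
  obtain ⟨M, hM⟩ := (insert B S).exists_le
  refine ⟨M + 1, fun x hx => ?_, hB _ ?_⟩
  · linarith [hM x (Finset.mem_insert_of_mem hx)]
  · linarith [hM B (Finset.mem_insert_self _ _)]

theorem signMatch_insert [IsStrictOrderedRing R'] {φ : C →+* R} {φ' : C →+* R'}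
    (hR : PolynomialIVT R)
    (hR' : PolynomialIVT R') {E : Finset C[X]} [DecidableEq C[X]] {f : C[X]}
    (hf : ∀ i, SignType.sign (φ (f.coeff i)) = SignType.sign (φ' (f.coeff i)))
    (hE : ∀ g ∈ E, ∀ i, SignType.sign (φ (g.coeff i)) = SignType.sign (φ' (g.coeff i)))
    (hder : derivative f ∈ E)
    (h₁ : ∀ S : Finset R, ∃ σ : R → R', StrictMonoOn σ S ∧ (∀ g ∈ E, ∀ s ∈ S,
      SignType.sign ((g.map φ).eval s) = SignType.sign ((g.map φ').eval (σ s))) ∧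
      ∀ s ∈ S, s ∈ rootsOfNonzero φ E →
        SignType.sign ((f.map φ).eval s) = SignType.sign ((f.map φ').eval (σ s)))
    (h₂ : SignMatch φ' φ E) : SignMatch φ φ' (insert f E) := by
  classical
  intro S
  set Z := rootsOfNonzero φ E with hZ
  set Z' := rootsOfNonzero φ' E with hZ'
  obtain ⟨σ₀, hσ₀, hsign₀, hsignf₀⟩ := h₁ (S ∪ Z)
  have hcard : Z'.card ≤ Z.card := by
    obtain ⟨τ, hτ, hτs⟩ := h₂ Z'
    refine Finset.card_le_card_of_injOn τ (fun z hz => ?_) hτ.injOn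
    exact (mem_rootsOfNonzero_of_sign_eq (fun g hg i => (hE g hg i).symm)
      fun g hg => hτs g hg z hz).1 hz
  have hmaps : ∀ z ∈ S ∪ Z, (z ∈ Z ↔ σ₀ z ∈ Z') := fun z hz =>
    mem_rootsOfNonzero_of_sign_eq hE fun g hg => hsign₀ g hg z hz
  have hsurj : ∀ z' ∈ Z', ∃ z ∈ Z, σ₀ z = z' := by
    have := Finset.surj_on_of_inj_on_of_card_le (s := Z) (t := Z') (fun z _ => σ₀ z)
      (fun z hz => (hmaps z (Finset.mem_union_right _ hz)).1 hz)
      (fun a b ha hb hab => hσ₀.injOn (by simp [ha]) (by simp [hb]) hab) hcard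
    intro z' hz'
    obtain ⟨z, hz, h⟩ := this z' hz'
    exact ⟨z, hz, h.symm⟩
  by_cases hd0 : (derivative f).map φ = 0
  · have hc : (f.map φ).natDegree = 0 := by
      rw [← derivative_map] at hd0
      exact derivative_eq_zero.1 hd0
    have hc' := (natDegree_map_congr hf).symm.trans hc
    refine ⟨σ₀, hσ₀.mono (by simp), fun g hg s hs => ?_⟩
    rcases Finset.mem_insert.1 hg with rfl | hg
    · rw [eq_C_of_natDegree_eq_zero hc, eq_C_of_natDegree_eq_zero hc']
      simpa using hf 0
    · exact hsign₀ g hg s (by simp [hs])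
  have hd0' : (derivative f).map φ' ≠ 0 := (map_ne_zero_congr (hE _ hder)).1 hd0
  have hdZ : ∀ c, (derivative (f.map φ)).eval c = 0 → c ∈ Z := fun c hc =>
    mem_rootsOfNonzero.2 ⟨_, hder, hd0, by rwa [derivative_map] at hc⟩
  have hdZ' : ∀ c, (derivative (f.map φ')).eval c = 0 → c ∈ Z' := fun c hc =>
    mem_rootsOfNonzero.2 ⟨_, hder, hd0', by rwa [derivative_map] at hc⟩
  have hends : ∃ a b : R, ∃ a' b' : R', (∀ x ∈ S ∪ Z, a < x ∧ x < b) ∧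
      (∀ x ∈ Z', a' < x ∧ x < b') ∧ a < b ∧ a' < b' ∧
      SignType.sign ((f.map φ).eval a) = SignType.sign ((f.map φ').eval a') ∧
      SignType.sign ((f.map φ).eval b) = SignType.sign ((f.map φ').eval b') := by
    obtain ⟨a, ha, haf⟩ := (f.map φ).exists_lt_sign_eval_eq (S ∪ Z)
    obtain ⟨a', ha', haf'⟩ := (f.map φ').exists_lt_sign_eval_eq Z'
    obtain ⟨b, hb, hbf⟩ := (f.map φ).exists_gt_sign_eval_eq (insert a (S ∪ Z))
    obtain ⟨b', hb', hbf'⟩ := (f.map φ').exists_gt_sign_eval_eq (insert a' Z')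
    have hl : SignType.sign (f.map φ).leadingCoeff = SignType.sign (f.map φ').leadingCoeff := by
      rw [leadingCoeff, leadingCoeff, natDegree_map_congr hf, coeff_map, coeff_map, hf]
    refine ⟨a, b, a', b', fun x hx => ⟨ha x hx, hb x (Finset.mem_insert_of_mem hx)⟩,
      fun x hx => ⟨ha' x hx, hb' x (Finset.mem_insert_of_mem hx)⟩,
      hb a (Finset.mem_insert_self _ _), hb' a' (Finset.mem_insert_self _ _), ?_, ?_⟩
    · rw [haf, haf', natDegree_map_congr hf, sign_mul, sign_mul, hl]
      congr 1
      rcases neg_one_pow_eq_or ℤ (f.map φ').natDegree with h | h <;>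
        rcases Nat.even_or_odd (f.map φ').natDegree with h | h <;> simp [h.neg_one_pow]
    · rw [hbf, hbf', hl]
  obtain ⟨a, b, a', b', hab, hab', halb, halb', hfa, hfb⟩ := hends
  have key : ∀ T : Finset R, T ⊆ S → ∃ σ : R → R', StrictMonoOn σ ↑({a, b} ∪ Z ∪ T) ∧
      (∀ z ∈ Z, σ z = σ₀ z) ∧ ∀ s ∈ {a, b} ∪ Z ∪ T,
        SignType.sign ((f.map φ).eval s) = SignType.sign ((f.map φ').eval (σ s)) := by
    intro T
    induction T using Finset.induction_on with
    | empty =>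
      intro _
      have haZ : a ∉ Z := fun h => lt_irrefl _ (hab a (by simp [h])).1
      have hbZ : b ∉ Z := fun h => lt_irrefl _ (hab b (by simp [h])).2
      have hσa : Function.update (Function.update σ₀ a a') b b' a = a' := by
        rw [Function.update_of_ne halb.ne, Function.update_self]
      have hσb : Function.update (Function.update σ₀ a a') b b' b = b' := Function.update_self ..
      have hσz : ∀ z ∈ Z, Function.update (Function.update σ₀ a a') b b' z = σ₀ z := fun z hz => by
        rw [Function.update_of_ne (by rintro rfl; exact hbZ hz),
          Function.update_of_ne (by rintro rfl; exact haZ hz)]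
      have hZσ : ∀ z ∈ Z, a' < σ₀ z ∧ σ₀ z < b' := fun z hz =>
        hab' _ ((hmaps z (Finset.mem_union_right _ hz)).1 hz)
      have hZab : ∀ z ∈ Z, a < z ∧ z < b := fun z hz => hab z (Finset.mem_union_right _ hz)
      refine ⟨Function.update (Function.update σ₀ a a') b b', fun x hx y hy hxy => ?_, hσz, ?_⟩
      · simp only [Finset.union_empty, Finset.coe_union, Finset.coe_insert, Finset.coe_singleton,
          Set.mem_union, Set.mem_insert_iff, Set.mem_singleton_iff, Finset.mem_coe] at hx hy
        rcases hx with (rfl | rfl) | hx <;> rcases hy with (rfl | rfl) | hy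
        · exact absurd hxy (lt_irrefl _)
        · rwa [hσa, hσb]
        · rw [hσa, hσz y hy]
          exact (hZσ y hy).1
        · exact absurd hxy halb.asymm
        · exact absurd hxy (lt_irrefl _)
        · exact absurd hxy (hZab y hy).2.asymm
        · exact absurd hxy (hZab x hx).1.asymm
        · rw [hσb, hσz x hx]
          exact (hZσ x hx).2
        · rw [hσz x hx, hσz y hy]
          exact hσ₀ (by simp [hx]) (by simp [hy]) hxy
      · intro s hs
        simp only [Finset.union_empty, Finset.mem_union, Finset.mem_insert,
          Finset.mem_singleton] at hs
        rcases hs with (rfl | rfl) | hs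
        · rw [hσa, hfa]
        · rw [hσb, hfb]
        · rw [hσz s hs]
          exact hsignf₀ s (Finset.mem_union_right _ hs) hs
    | insert s T hsT ih =>
      intro hTS
      obtain ⟨σ, hσ, hσZ, hσf⟩ := ih ((Finset.subset_insert _ _).trans hTS)
      have hsS : s ∈ S := hTS (Finset.mem_insert_self _ _)
      set U := {a, b} ∪ Z ∪ T with hU
      have hUi : {a, b} ∪ Z ∪ insert s T = insert s U := by
        rw [hU, Finset.union_insert]
      rw [hUi]
      by_cases hsU : s ∈ U
      · rw [Finset.insert_eq_of_mem hsU]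
        exact ⟨σ, hσ, hσZ, hσf⟩
      have hZU : Z ⊆ U := fun z hz => by simp [hU, hz]
      have hl : (U.filter (· < s)).Nonempty := ⟨a, by simp [hU, (hab s (by simp [hsS])).1]⟩
      have hr : (U.filter (s < ·)).Nonempty := ⟨b, by simp [hU, (hab s (by simp [hsS])).2]⟩
      obtain ⟨t₁, ht₁, hmax⟩ := Finset.exists_max_image _ id hl
      obtain ⟨t₂, ht₂, hmin⟩ := Finset.exists_min_image _ id hr
      simp only [Finset.mem_filter, id, and_imp] at ht₁ ht₂ hmax hmin
      have hlt := hσ ht₁.1 ht₂.1 (ht₁.2.trans ht₂.2)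
      have hgap : ∀ z ∈ U, z ≤ t₁ ∨ t₂ ≤ z := by
        intro z hz
        rcases lt_trichotomy z s with h | rfl | h
        · exact .inl (hmax z hz h)
        · exact absurd hz hsU
        · exact .inr (hmin z hz h)
      obtain ⟨v, hv, hvs⟩ := exists_strictly_between_sign_eq
        (hR.eval_strictly_between (f.map φ) (a := t₁) (b := t₂) (x := s) ⟨ht₁.2, ht₂.2⟩ (by
          intro c hc h0
          rcases hgap c (hZU (hdZ c h0)) with h | h
          · exact absurd hc.1 (not_lt.2 h)
          · exact absurd hc.2 (not_lt.2 h)))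
        (a' := (f.map φ').eval (σ t₁)) (b' := (f.map φ').eval (σ t₂)) (by
          intro h
          obtain ⟨c, hc, h0⟩ := hR'.exists_derivative_eval_eq_zero _ hlt h
          obtain ⟨z, hz, rfl⟩ := hsurj c (hdZ' c h0)
          rw [← hσZ z hz] at hc
          rcases hgap z (hZU hz) with h | h
          · exact absurd hc.1 (not_lt.2 (hσ.monotoneOn (hZU hz) ht₁.1 h))
          · exact absurd hc.2 (not_lt.2 (hσ.monotoneOn ht₂.1 (hZU hz) h)))
        (hσf _ ht₁.1) (hσf _ ht₂.1)
      obtain ⟨u, hu, huv⟩ := hR'.exists_eval_eq _ hlt hv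
      have hupd : ∀ x ∈ U, Function.update σ s u x = σ x := fun x hx =>
        Function.update_of_ne (by rintro rfl; exact hsU hx) _ _
      refine ⟨Function.update σ s u, ?_, fun z hz => (hupd z (hZU hz)).trans (hσZ z hz), ?_⟩
      · rw [Finset.coe_insert]
        intro x hx y hy hxy
        rcases hx with rfl | hx <;> rcases hy with rfl | hy
        · exact absurd hxy (lt_irrefl _)
        · rw [Function.update_self, hupd y hy]
          exact hu.2.trans_le (hσ.monotoneOn ht₂.1 hy (hmin y hy hxy))
        · rw [Function.update_self, hupd x hx]
          exact (hσ.monotoneOn hx ht₁.1 (hmax x hx hxy)).trans_lt hu.1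
        · rw [hupd x hx, hupd y hy]
          exact hσ hx hy hxy
      · intro x hx
        rcases Finset.mem_insert.1 hx with rfl | hx
        · rw [Function.update_self, huv, hvs]
        · rw [hupd x hx]
          exact hσf x hx
  obtain ⟨σ, hσ, hσZ, hσf⟩ := key S subset_rfl
  refine ⟨σ, hσ.mono (fun x hx => by simp [Finset.mem_coe.1 hx]), fun g hg s hs => ?_⟩
  rcases Finset.mem_insert.1 hg with rfl | hg
  · exact hσf s (by simp [hs])
  rw [hsign₀ g hg s (by simp [hs])]
  by_cases hsZ : s ∈ Z
  · rw [hσZ s hsZ]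
  by_cases hg0 : g.map φ' = 0
  · simp [hg0]
  apply hR'.sign_eval_eq
  intro c hc h0
  obtain ⟨z, hz, rfl⟩ := hsurj c (mem_rootsOfNonzero.2 ⟨g, hg, hg0, h0⟩)
  have hzs : z ≠ s := by rintro rfl; exact hsZ hz
  rcases lt_or_gt_of_ne hzs with h | h
  · have h3 := hσ₀ (a := z) (b := s) (by simp [hz]) (by simp [hs]) h
    have h4 := hσ (a := z) (b := s) (by simp [hz]) (by simp [hs]) h
    rw [hσZ z hz] at h4
    rcases Set.mem_uIcc.1 hc with h5 | h5 <;> order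
  · have h3 := hσ₀ (a := s) (b := z) (by simp [hs]) (by simp [hz]) h
    have h4 := hσ (a := s) (b := z) (by simp [hs]) (by simp [hz]) h
    rw [hσZ z hz] at h4
    rcases Set.mem_uIcc.1 hc with h5 | h5 <;> order

end SignMatch

section Parametric

variable {C R R' : Type*} [CommRing C] [Field R] [LinearOrder R] [Field R'] [LinearOrder R']

theorem SignMatch.mono {φ : C →+* R} {φ' : C →+* R'} {E F : Finset C[X]} (h : SignMatch φ φ' F)
    (hEF : E ⊆ F) : SignMatch φ φ' E := fun S => by
  obtain ⟨σ, hσ, hs⟩ := h S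
  exact ⟨σ, hσ, fun f hf => hs f (hEF hf)⟩

theorem Polynomial.exists_pseudo_divMod {A : Type*} [CommRing A] (f g : A[X]) (hg : g ≠ 0) :
    ∃ (k : ℕ) (q r : A[X]), Polynomial.C ((g.leadingCoeff ^ k) ^ 2) * f = q * g + r ∧
      r.degree < g.degree := by
  suffices h : ∀ (N : ℕ) (f : A[X]), f.degree < N → ∃ (k : ℕ) (q r : A[X]),
      Polynomial.C ((g.leadingCoeff ^ k) ^ 2) * f = q * g + r ∧ r.degree < g.degree from
    h (f.natDegree + 1) f (by
      rw [degree_lt_iff_coeff_zero]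
      exact fun m hm => coeff_eq_zero_of_natDegree_lt hm)
  intro N
  induction N with
  | zero =>
    intro f hf
    have : f = 0 := by simpa [Nat.cast_withBot] using hf
    exact ⟨0, 0, 0, by simp [this], by simpa [bot_lt_iff_ne_bot] using hg⟩
  | succ N ih =>
    intro f hf
    rcases lt_or_ge N g.natDegree with hN | hN
    · refine ⟨0, 0, f, by simp, ?_⟩
      rw [degree_eq_natDegree hg]
      exact hf.trans_le (by exact_mod_cast hN)
    · obtain ⟨k, q, r, h, hr⟩ := ih (Polynomial.C (g.leadingCoeff ^ 2) * f -
        g * Polynomial.C (g.leadingCoeff * f.coeff N) * X ^ (N - g.natDegree)) (by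
          rw [degree_lt_iff_coeff_zero] at hf ⊢
          intro m hm
          rw [coeff_sub, coeff_C_mul, coeff_mul_X_pow', if_pos (by omega), coeff_mul_C]
          rcases hm.eq_or_lt with rfl | hm
          · rw [Nat.sub_sub_self hN]
            simp only [leadingCoeff]
            ring
          · rw [hf m (by omega), coeff_eq_zero_of_natDegree_lt (p := g) (by omega)]
            ring)
      refine ⟨k + 1, q + Polynomial.C ((g.leadingCoeff ^ k) ^ 2) *
        (Polynomial.C (g.leadingCoeff * f.coeff N) * X ^ (N - g.natDegree)), r, ?_, hr⟩
      linear_combination h + (by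
        simp only [map_pow]; ring : (Polynomial.C ((g.leadingCoeff ^ (k + 1)) ^ 2) * f
        = Polynomial.C ((g.leadingCoeff ^ k) ^ 2) * (Polynomial.C (g.leadingCoeff ^ 2) * f)))

theorem Polynomial.exists_remainder {C R : Type*} [CommRing C] [Field R] (φ : C →+* R) (f g : C[X]) :
    ∃ (h q r : C[X]) (c : C), h.map φ = g.map φ ∧ φ c ≠ 0 ∧ (∀ d : ℕ, g.degree < d + 1 →
      r.degree < d) ∧ (h = 0 ∨ Polynomial.C (c ^ 2) * f = q * h + r) := by
  obtain ⟨h, hh, hd⟩ := exists_degree_eq_of_mem_lifts (f := φ) (p := g.map φ)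
    ((mem_lifts _).2 ⟨g, rfl⟩)
  rcases eq_or_ne h 0 with rfl | h0
  · exact ⟨0, 0, 0, 1, hh, by simp, fun d _ => by simp, .inl rfl⟩
  obtain ⟨k, q, r, hr, hrd⟩ := exists_pseudo_divMod f h h0
  refine ⟨h, q, r, h.leadingCoeff ^ k, hh, ?_, fun d hg => ?_, .inr hr⟩
  · have hg0 : g.map φ ≠ 0 := by
      rwa [← degree_ne_bot, ← hd, degree_ne_bot]
    rw [map_pow, leadingCoeff, ← coeff_map, hh, natDegree_eq_of_degree_eq hd]
    exact pow_ne_zero _ (leadingCoeff_ne_zero.2 hg0)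
  · refine hrd.trans_le ?_
    have := (hd.trans_le degree_map_le).trans_lt hg
    rw [degree_eq_natDegree h0] at this ⊢
    exact_mod_cast Nat.lt_succ_iff.1 (by exact_mod_cast this)

theorem Polynomial.sign_eval_map_eq_of_remainder [IsStrictOrderedRing R] {φ : C →+* R}
    {f g h q r : C[X]} {c : C}
    (hh : h.map φ = g.map φ) (hc : φ c ≠ 0) (hr : h = 0 ∨ Polynomial.C (c ^ 2) * f = q * h + r)
    {z : R} (hg : g.map φ ≠ 0) (hz : (g.map φ).eval z = 0) :
    SignType.sign ((f.map φ).eval z) = SignType.sign ((r.map φ).eval z) := by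
  rcases hr with rfl | hr
  · simp [← hh] at hg
  have := congrArg (fun p => (p.map φ).eval z) hr
  simp only [Polynomial.map_mul, Polynomial.map_add, map_C, eval_mul, eval_add, eval_C, hh, hz,
    mul_zero, zero_add] at this
  have hc2 : 0 < φ (c ^ 2) := by
    rw [map_pow]
    positivity
  rw [← this, sign_mul, _root_.sign_pos hc2, one_mul]

theorem signMatch_insert_of_remainder [IsStrictOrderedRing R] [IsStrictOrderedRing R']
    [DecidableEq C[X]] {φ : C →+* R} {φ' : C →+* R'} (hR : PolynomialIVT R)
    (hR' : PolynomialIVT R') {E : Finset C[X]} {f : C[X]}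
    (hf : ∀ i, SignType.sign (φ (f.coeff i)) = SignType.sign (φ' (f.coeff i)))
    (hE : ∀ g ∈ E, ∀ i, SignType.sign (φ (g.coeff i)) = SignType.sign (φ' (g.coeff i)))
    (hder : derivative f ∈ E) {rem : C[X] → C[X]}
    (hrem : ∀ g ∈ E, ∀ z, g.map φ ≠ 0 → (g.map φ).eval z = 0 →
      SignType.sign ((f.map φ).eval z) = SignType.sign (((rem g).map φ).eval z))
    (hrem' : ∀ g ∈ E, ∀ z, g.map φ' ≠ 0 → (g.map φ').eval z = 0 →
      SignType.sign ((f.map φ').eval z) = SignType.sign (((rem g).map φ').eval z))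
    (h₁ : SignMatch φ φ' (E ∪ E.image rem)) (h₂ : SignMatch φ' φ E) :
    SignMatch φ φ' (insert f E) := by
  refine signMatch_insert hR hR' hf hE hder (fun S => ?_) h₂
  obtain ⟨σ, hσ, hs⟩ := h₁ S
  refine ⟨σ, hσ, fun g hg => hs g (Finset.mem_union_left _ hg), fun s hsS hsE => ?_⟩
  obtain ⟨g, hg, hg0, hgs⟩ := mem_rootsOfNonzero.1 hsE
  rw [hrem g hg s hg0 hgs, hs _ (Finset.mem_union_right _ (Finset.mem_image_of_mem _ hg)) s hsS,
    hrem' g hg _ ((map_ne_zero_congr (hE g hg)).1 hg0)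
      ((sign_eq_zero_congr (hs g (Finset.mem_union_left _ hg) s hsS)).1 hgs)]

theorem exists_finset_signMatch [IsStrictOrderedRing R] [IsStrictOrderedRing R']
    (hR : PolynomialIVT R) (hR' : PolynomialIVT R') (φ : C →+* R) (F : Finset C[X]) :
    ∃ G : Finset C, ∀ φ' : C →+* R', (∀ c ∈ G, SignType.sign (φ c) = SignType.sign (φ' c)) →
      SignMatch φ φ' F ∧ SignMatch φ' φ F := by
  classical
  suffices h : ∀ (d : ℕ) (F : Finset C[X]), (∀ f ∈ F, f.degree < d) → ∃ G : Finset C,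
      ∀ φ' : C →+* R', (∀ c ∈ G, SignType.sign (φ c) = SignType.sign (φ' c)) →
      SignMatch φ φ' F ∧ SignMatch φ' φ F by
    refine h (F.sup natDegree + 1) F fun f hf => ?_
    rw [degree_lt_iff_coeff_zero]
    exact fun m hm => coeff_eq_zero_of_natDegree_lt
      ((Finset.le_sup (f := natDegree) hf).trans_lt hm)
  intro d
  induction d with
  | zero =>
    intro F hF
    have hF0 : ∀ f ∈ F, f = 0 := fun f hf => by simpa [Nat.cast_withBot] using hF f hf
    refine ⟨∅, fun φ' _ => ⟨fun S => ?_, fun S => ?_⟩⟩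
    · obtain ⟨σ, hσ⟩ := S.exists_strictMonoOn R'
      exact ⟨σ, hσ, fun f hf => by simp [hF0 f hf]⟩
    · obtain ⟨σ, hσ⟩ := S.exists_strictMonoOn R
      exact ⟨σ, hσ, fun f hf => by simp [hF0 f hf]⟩
  | succ d ih =>
    suffices h : ∀ (F₂ F₁ : Finset C[X]), (∀ f ∈ F₂, f.degree < (d + 1 : ℕ)) →
        (∀ f ∈ F₁, f.degree < d) → ∃ G : Finset C,
        ∀ φ' : C →+* R', (∀ c ∈ G, SignType.sign (φ c) = SignType.sign (φ' c)) →
        SignMatch φ φ' (F₁ ∪ F₂) ∧ SignMatch φ' φ (F₁ ∪ F₂) by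
      intro F hF
      simpa using h F ∅ hF (by simp)
    intro F₂
    induction F₂ using Finset.induction_on with
    | empty =>
      intro F₁ _ hF₁
      simpa using ih F₁ hF₁
    | insert f F₂ _ ih₂ =>
      intro F₁ hF₂ hF₁
      set E := insert (derivative f) F₁ ∪ F₂ with hE
      choose h q rem c hh hc hdeg hrem using exists_remainder φ f
      have hfd := hF₂ f (Finset.mem_insert_self _ _)
      have hF₁' : ∀ g ∈ insert (derivative f) F₁, g.degree < d := by
        intro g hg
        rcases Finset.mem_insert.1 hg with rfl | hg
        · rcases eq_or_ne f 0 with rfl | hf0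
          · simp
          · exact (degree_derivative_lt hf0).trans_le (by
              rw [degree_eq_natDegree hf0] at hfd ⊢
              exact_mod_cast Nat.lt_succ_iff.1 (by exact_mod_cast hfd))
        · exact hF₁ g hg
      have hEd : ∀ g ∈ E, g.degree < (d + 1 : ℕ) := by
        intro g hg
        rcases Finset.mem_union.1 hg with hg | hg
        · exact (hF₁' g hg).trans (by exact_mod_cast d.lt_succ_self)
        · exact hF₂ g (Finset.mem_insert_of_mem hg)
      obtain ⟨G, hG⟩ := ih₂ (insert (derivative f) F₁ ∪ E.image rem)
        (fun g hg => hF₂ g (Finset.mem_insert_of_mem hg)) (by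
          intro g hg
          rcases Finset.mem_union.1 hg with hg | hg
          · exact hF₁' g hg
          · obtain ⟨g', hg', rfl⟩ := Finset.mem_image.1 hg
            exact hdeg g' d (by exact_mod_cast hEd g' hg'))
      refine ⟨G ∪ (f.coeffs ∪ E.biUnion coeffs) ∪ (E.image c ∪ E.biUnion fun g => (h g - g).coeffs),
        fun φ' hφ' => ?_⟩
      obtain ⟨hm, hm'⟩ := hG φ' fun a ha => hφ' a (by simp [ha])
      have hcoeff : ∀ g : C[X], (∀ a ∈ g.coeffs, SignType.sign (φ a) = SignType.sign (φ' a)) →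
          ∀ i, SignType.sign (φ (g.coeff i)) = SignType.sign (φ' (g.coeff i)) := by
        intro g hg i
        by_cases hi : g.coeff i = 0
        · simp [hi]
        · exact hg _ (coeff_mem_coeffs hi)
      have hfc := hcoeff f fun a ha => hφ' a (by simp [ha])
      have hEc : ∀ g ∈ E, ∀ i, SignType.sign (φ (g.coeff i)) = SignType.sign (φ' (g.coeff i)) :=
        fun g hg => hcoeff g fun a ha => hφ' a (by
          simp only [Finset.mem_union, Finset.mem_biUnion]
          exact .inl (.inr (.inr ⟨g, hg, ha⟩)))
      have hc' : ∀ g ∈ E, φ' (c g) ≠ 0 := fun g hg => by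
        rw [Ne, ← sign_eq_zero_congr (hφ' (c g) (by
          simp only [Finset.mem_union, Finset.mem_image]
          exact .inr (.inl ⟨g, hg, rfl⟩)))]
        exact hc g
      have hh' : ∀ g ∈ E, (h g).map φ' = g.map φ' := fun g hg => by
        have := (map_ne_zero_congr (φ := φ) (φ' := φ') (hcoeff (h g - g) fun a ha => hφ' a (by
          simp only [Finset.mem_union, Finset.mem_biUnion]
          exact .inr (.inr ⟨g, hg, ha⟩)))).not
        simp only [not_not, Polynomial.map_sub, sub_eq_zero] at this
        exact this.1 (hh g)
      have hsub : insert (derivative f) F₁ ∪ E.image rem ∪ F₂ = E ∪ E.image rem := by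
        rw [hE, Finset.union_right_comm]
      rw [hsub] at hm hm'
      have hder : derivative f ∈ E := by simp [hE]
      have hr : ∀ g ∈ E, ∀ z, g.map φ ≠ 0 → (g.map φ).eval z = 0 →
          SignType.sign ((f.map φ).eval z) = SignType.sign (((rem g).map φ).eval z) :=
        fun g _ z => sign_eval_map_eq_of_remainder (hh g) (hc g) (hrem g)
      have hr' : ∀ g ∈ E, ∀ z, g.map φ' ≠ 0 → (g.map φ').eval z = 0 →
          SignType.sign ((f.map φ').eval z) = SignType.sign (((rem g).map φ').eval z) :=
        fun g hg z => sign_eval_map_eq_of_remainder (hh' g hg) (hc' g hg) (hrem g)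
      have hFE : F₁ ∪ insert f F₂ ⊆ insert f E := by
        intro g
        simp only [hE, Finset.mem_union, Finset.mem_insert]
        tauto
      exact ⟨(signMatch_insert_of_remainder hR hR' hfc hEc hder hr hr' hm
          (hm'.mono Finset.subset_union_left)).mono hFE,
        (signMatch_insert_of_remainder hR' hR (fun i => (hfc i).symm)
          (fun g hg i => (hEc g hg i).symm) hder hr' hr hm'
          (hm.mono Finset.subset_union_left)).mono hFE⟩

end Parametric

theorem sign_algebraMap_real {R : Type*} [Field R] [LinearOrder R] [IsStrictOrderedRing R]
    [Algebra ℝ R] (c : ℝ) : SignType.sign (algebraMap ℝ R c) = SignType.sign c := by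
  have hpos : ∀ c : ℝ, 0 < c → 0 < algebraMap ℝ R c := fun c hc => by
    rw [← Real.sq_sqrt hc.le, map_pow]
    have : algebraMap ℝ R (√c) ≠ 0 := by
      simpa using (Real.sqrt_pos.2 hc).ne'
    positivity
  rcases lt_trichotomy c 0 with hc | rfl | hc
  · have := hpos (-c) (neg_pos.2 hc)
    rw [map_neg] at this
    rw [sign_neg hc, sign_neg (neg_pos.1 this)]
  · simp
  · rw [sign_pos hc, sign_pos (hpos c hc)]

theorem MvPolynomial.aeval_eq_eval_map_finSuccEquiv {A S : Type*} [CommRing A] [CommRing S]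
    [Algebra A S] {n : ℕ} (x : Fin (n + 1) → S) (f : MvPolynomial (Fin (n + 1)) A) :
    aeval x f = ((finSuccEquiv A n f).map (aeval (R := A) (Fin.tail x)).toRingHom).eval (x 0) := by
  induction f using MvPolynomial.induction_on with
  | C a => simp [finSuccEquiv_apply]
  | add p q hp hq => simp only [map_add, Polynomial.map_add, Polynomial.eval_add, hp, hq]
  | mul_X p i hp =>
    simp only [map_mul, Polynomial.map_mul, Polynomial.eval_mul, hp, aeval_X]
    congr 1
    refine Fin.cases ?_ (fun i => ?_) i
    · simp [finSuccEquiv_X_zero]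
    · simp [finSuccEquiv_X_succ, Fin.tail]

theorem exists_real_sign_aeval_eq {R : Type*} [Field R] [LinearOrder R] [IsStrictOrderedRing R]
    [Algebra ℝ R] (hR : PolynomialIVT R) (n : ℕ) (F : Finset (MvPolynomial (Fin n) ℝ))
    (x : Fin n → R) : ∃ y : Fin n → ℝ, ∀ f ∈ F,
      SignType.sign (MvPolynomial.aeval x f) = SignType.sign (MvPolynomial.aeval y f) := by
  classical
  induction n with
  | zero =>
    refine ⟨Fin.elim0, fun f _ => ?_⟩
    rw [MvPolynomial.eq_C_of_isEmpty f, MvPolynomial.aeval_C, MvPolynomial.aeval_C,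
      sign_algebraMap_real]
    rfl
  | succ n ih =>
    obtain ⟨G, hG⟩ := exists_finset_signMatch hR polynomialIVT_real
      (MvPolynomial.aeval (R := ℝ) (Fin.tail x)).toRingHom (F.image (MvPolynomial.finSuccEquiv ℝ n))
    obtain ⟨y, hy⟩ := ih G (Fin.tail x)
    obtain ⟨σ, -, hσ⟩ := (hG (MvPolynomial.aeval y).toRingHom hy).1 {x 0}
    refine ⟨Fin.cons (σ (x 0)) y, fun f hf => ?_⟩
    have := hσ _ (Finset.mem_image_of_mem _ hf) (x 0) (by simp)
    rw [MvPolynomial.aeval_eq_eval_map_finSuccEquiv, MvPolynomial.aeval_eq_eval_map_finSuccEquiv]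
    simpa using this

theorem IsSumSq.map {A B F : Type*} [Semiring A] [Semiring B] [FunLike F A B] [RingHomClass F A B]
    {a : A} (ha : IsSumSq a) (f : F) : IsSumSq (f a) := by
  induction ha with
  | zero => simp
  | sq_add a hs ih =>
    rw [map_add, map_mul]
    exact .sq_add _ ih

theorem Polynomial.natDegree_le_and_isSumSq_coeff_add {R : Type*} [CommRing R] {m : ℕ}
    {p q : R[X]} (hp : p.natDegree ≤ m) (hq : q.natDegree ≤ m + m)
    (hqs : IsSumSq (q.coeff (m + m))) :
    (p * p + q).natDegree ≤ m + m ∧ IsSumSq ((p * p + q).coeff (m + m)) := by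
  refine ⟨natDegree_add_le_of_degree_le (natDegree_mul_le_of_le hp hp) hq, ?_⟩
  rw [coeff_add, coeff_mul_add_eq_of_natDegree_le hp hp]
  exact .sq_add _ hqs

section Adjoin

variable {R L : Type*} [Field R] [Field L] [Algebra R L]

theorem IntermediateField.exists_isSumSq_polynomial {α : L} (hα : IsIntegral R α)
    {x : IntermediateField.adjoin R {α}} (hx : IsSumSq x) :
    ∃ q : R[X], IsSumSq q ∧ aeval α q = (x : L) ∧
      q.natDegree ≤ ((minpoly R α).natDegree - 1) + ((minpoly R α).natDegree - 1) ∧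
      IsSumSq (q.coeff (((minpoly R α).natDegree - 1) + ((minpoly R α).natDegree - 1))) := by
  induction hx with
  | zero => exact ⟨0, .zero, by simp, by simp, by simp⟩
  | sq_add a hs ih =>
    obtain ⟨q, hq, hqx, hqd, hqc⟩ := ih
    obtain ⟨p, hp, hpa⟩ := (IntermediateField.adjoin.powerBasis hα).exists_eq_aeval a
    rw [IntermediateField.adjoin.powerBasis_dim] at hp
    rw [IntermediateField.adjoin.powerBasis_gen] at hpa
    have hpa' : aeval α p = (a : L) := by
      rw [hpa, ← IntermediateField.algebraMap_apply, ← aeval_algebraMap_apply]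
      simp
    obtain ⟨h1, h2⟩ := natDegree_le_and_isSumSq_coeff_add (Nat.le_sub_one_of_lt hp) hqd hqc
    exact ⟨p * p + q, .sq_add _ hq, by simp [hpa', hqx], h1, h2⟩

theorem Irreducible.exists_one_add_isSumSq_eq_mul [IsAlgClosed L]
    (hmax : ∀ α : L, α ∉ Set.range (algebraMap R L) →
      IsSumSq (-1 : IntermediateField.adjoin R {α}))
    {f : R[X]} (hf : Irreducible f) {m : ℕ} (hd : f.natDegree = m + 2) :
    ∃ q k : R[X], IsSumSq q ∧ 1 + q = f * k ∧ q.natDegree ≤ (m + 1) + (m + 1) ∧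
      IsSumSq (q.coeff ((m + 1) + (m + 1))) := by
  obtain ⟨α, hα⟩ := IsAlgClosed.exists_aeval_eq_zero L f (by
    rw [degree_eq_natDegree hf.ne_zero, hd]
    exact Nat.cast_ne_zero.2 (Nat.succ_ne_zero _))
  have hint : IsIntegral R α := (isAlgebraic_iff_isIntegral).1 ⟨f, hf.ne_zero, hα⟩
  have hmin := minpoly.eq_of_irreducible hf hα
  have hlc : f.leadingCoeff⁻¹ ≠ 0 := inv_ne_zero (leadingCoeff_ne_zero.2 hf.ne_zero)
  have hmd : (minpoly R α).natDegree = m + 2 := by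
    rw [← hmin, natDegree_mul_C hlc, hd]
  have hmem : α ∉ Set.range (algebraMap R L) := by
    rintro ⟨r, rfl⟩
    rw [minpoly.eq_X_sub_C] at hmd
    simp at hmd
  obtain ⟨q, hq, hqα, hqd, hqc⟩ :=
    IntermediateField.exists_isSumSq_polynomial hint (hmax α hmem)
  rw [hmd] at hqd hqc
  obtain ⟨k, hk⟩ : minpoly R α ∣ 1 + q := minpoly.dvd _ _ (by simp [hqα])
  exact ⟨q, C f.leadingCoeff⁻¹ * k, hq, by rw [hk, ← hmin, mul_assoc], hqd, hqc⟩

theorem isSumSq_or_isSumSq_neg [IsAlgClosed L] (hR : ¬ IsSumSq (-1 : R))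
    (hmax : ∀ α : L, α ∉ Set.range (algebraMap R L) →
      IsSumSq (-1 : IntermediateField.adjoin R {α})) (a : R) : IsSumSq a ∨ IsSumSq (-a) := by
  by_cases ha : ∃ b, b ^ 2 = a
  · obtain ⟨b, rfl⟩ := ha
    exact .inl (by rw [sq]; exact .mul_self b)
  push Not at ha
  have hd : (X ^ 2 - C a : R[X]).natDegree = 0 + 2 := natDegree_X_pow_sub_C
  obtain ⟨q, k, hq, hk, hqd, hqc⟩ :=
    (X_pow_sub_C_irreducible_of_prime Nat.prime_two ha).exists_one_add_isSumSq_eq_mul hmax hd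
  have hev : IsSumSq (q.eval 0) := hq.map (evalRingHom 0)
  have hk0 : k ≠ 0 := by
    rintro rfl
    apply hR
    have := congrArg (eval 0) hk
    simp only [mul_zero, eval_add, eval_one, eval_zero] at this
    rwa [← eq_neg_of_add_eq_zero_right this]
  have hkd : k.natDegree = 0 := by
    have h1 : (1 + q).natDegree ≤ 2 := natDegree_add_le_of_degree_le (by simp) hqd
    rw [hk, natDegree_mul (ne_zero_of_natDegree_gt (n := 0) (by omega)) hk0] at h1
    omega
  obtain ⟨c, rfl⟩ := natDegree_eq_zero.1 hkd
  have hc0 : c ≠ 0 := by simpa using hk0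
  have hqc' : q.coeff (0 + 1 + (0 + 1)) = c := by
    have := congrArg (fun p => coeff p 2) hk
    simpa [coeff_one, coeff_X_pow, coeff_C] using this
  rw [hqc'] at hqc
  have h0 : 1 + q.eval 0 = -a * c := by
    simpa using congrArg (eval 0) hk
  right
  have : -a = (1 + q.eval 0) * c * (c⁻¹ * c⁻¹) := by
    rw [h0]
    field_simp
  rw [this]
  exact ((IsSumSq.one.add hev).mul hqc).mul (.mul_self _)

theorem exists_linearOrder_of_isSumSq_or (hR : ¬ IsSumSq (-1 : R))
    (h : ∀ a : R, IsSumSq a ∨ IsSumSq (-a)) :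
    ∃ _ : LinearOrder R, IsStrictOrderedRing R := by
  classical
  let P : RingCone R :=
    { Subsemiring.sumSq R with
      eq_zero_of_mem_of_neg_mem' := by
        intro a ha hna
        have ha : IsSumSq a := Subsemiring.mem_sumSq.1 ha
        have hna : IsSumSq (-a) := Subsemiring.mem_sumSq.1 hna
        by_contra h0
        apply hR
        have : -1 = -a * a * (a⁻¹ * a⁻¹) := by
          field_simp
        rw [this]
        exact (hna.mul ha).mul (.mul_self _) }
  have : HasMemOrNegMem P := ⟨fun a => (h a).imp Subsemiring.mem_sumSq.2 Subsemiring.mem_sumSq.2⟩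
  let l : LinearOrder R := LinearOrder.mkOfAddGroupCone P
  have : IsOrderedRing R := IsOrderedRing.mkOfCone P
  exact ⟨l, IsOrderedRing.toIsStrictOrderedRing R⟩

theorem polynomialIVT_of_isSumSq_neg_one_adjoin [LinearOrder R] [IsStrictOrderedRing R]
    [IsAlgClosed L] (hmax : ∀ α : L, α ∉ Set.range (algebraMap R L) →
      IsSumSq (-1 : IntermediateField.adjoin R {α})) : PolynomialIVT R := by
  intro f
  induction hn : f.natDegree using Nat.strong_induction_on generalizing f with
  | _ n ih =>
  intro a b hab h
  have hf0 : f ≠ 0 := by rintro rfl; simp at h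
  rcases n with _ | n
  · obtain ⟨c, rfl⟩ := natDegree_eq_zero.1 hn
    simp only [eval_C] at h
    exact absurd h (mul_self_nonneg c).not_gt
  by_cases hirr : Irreducible f
  · rcases n with _ | m
    · obtain ⟨u, v, hu, rfl⟩ : ∃ u v : R, u ≠ 0 ∧ f = C u * X + C v :=
        ⟨f.coeff 1, f.coeff 0, by
          rw [show 1 = f.natDegree by omega]
          exact leadingCoeff_ne_zero.2 hf0, eq_X_add_C_of_natDegree_le_one hn.le⟩
      simp only [eval_add, eval_mul, eval_C, eval_X] at h
      have h1 : (a - -v / u) * (b - -v / u) < 0 := by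
        have : (u * a + v) * (u * b + v) = u ^ 2 * ((a - -v / u) * (b - -v / u)) := by
          field_simp
          ring
        rw [this] at h
        exact (pos_iff_neg_of_mul_neg h).1 (by positivity)
      refine ⟨-v / u, ?_, by simp; field_simp; ring⟩
      rcases mul_neg_iff.1 h1 with h2 | h2
      · exact absurd hab (by linarith)
      · exact ⟨by linarith, by linarith⟩
    · obtain ⟨q, k, hq, hk, hqd, -⟩ := hirr.exists_one_add_isSumSq_eq_mul hmax hn
      have hpos : ∀ x, 0 < f.eval x * k.eval x := fun x => by
        have : IsSumSq (q.eval x) := hq.map (evalRingHom x)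
        have := this.nonneg
        rw [← eval_mul, ← hk, eval_add, eval_one]
        linarith
      have hk0 : k ≠ 0 := by rintro rfl; simpa using hpos 0
      have hkd : k.natDegree < m + 1 + 1 := by
        have h1 : (1 + q).natDegree ≤ (m + 1) + (m + 1) :=
          natDegree_add_le_of_degree_le (by simp) hqd
        rw [hk, natDegree_mul hf0 hk0] at h1
        omega
      have hkab : k.eval a * k.eval b < 0 := by
        have := mul_pos (hpos a) (hpos b)
        have h2 : 0 < (f.eval a * f.eval b) * (k.eval a * k.eval b) := by linarith
        exact (neg_iff_neg_of_mul_pos h2).1 h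
      obtain ⟨c, -, hc⟩ := ih _ hkd k rfl a b hab hkab
      exact absurd (hpos c) (by simp [hc])
  · have hnu : ¬ IsUnit f := fun hu => by
      have := natDegree_eq_zero_of_isUnit hu
      omega
    obtain ⟨g, k, hg, hk, rfl⟩ : ∃ g k, ¬ IsUnit g ∧ ¬ IsUnit k ∧ f = g * k := by
      by_contra! hcon
      exact hirr ⟨hnu, fun {g k} hgk => by
        by_contra! hh
        exact hcon g k hh.1 hh.2 hgk⟩
    have hg0 := left_ne_zero_of_mul hf0
    have hk0 := right_ne_zero_of_mul hf0
    have hgd : 0 < g.natDegree := by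
      rw [Nat.pos_iff_ne_zero]
      exact fun h0 => hg (isUnit_iff_degree_eq_zero.2 (by rw [degree_eq_natDegree hg0, h0]; rfl))
    have hkd : 0 < k.natDegree := by
      rw [Nat.pos_iff_ne_zero]
      exact fun h0 => hk (isUnit_iff_degree_eq_zero.2 (by rw [degree_eq_natDegree hk0, h0]; rfl))
    rw [natDegree_mul hg0 hk0] at hn
    simp only [eval_mul] at h
    have h' : (g.eval a * g.eval b) * (k.eval a * k.eval b) < 0 := by linarith
    rcases mul_neg_iff.1 h' with h1 | h1
    · obtain ⟨c, hc, hc0⟩ := ih _ (by omega) k rfl a b hab h1.2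
      exact ⟨c, hc, by simp [hc0]⟩
    · obtain ⟨c, hc, hc0⟩ := ih _ (by omega) g rfl a b hab h1.1
      exact ⟨c, hc, by simp [hc0]⟩

end Adjoin

theorem IntermediateField.exists_isSumSq_of_isSumSq_sSup {K L : Type*} [Field K] [Field L]
    [Algebra K L] {c : Set (IntermediateField K L)} (hc : IsChain (· ≤ ·) c) (hne : c.Nonempty)
    {x : (sSup c : IntermediateField K L)} (hx : IsSumSq x) :
    ∃ E ∈ c, ∃ y : E, (y : L) = x ∧ IsSumSq y := by
  induction hx with
  | zero =>
    obtain ⟨E, hE⟩ := hne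
    exact ⟨E, hE, 0, by simp, .zero⟩
  | sq_add a hs ih =>
    obtain ⟨E, hE, y, hy, hys⟩ := ih
    have : Nonempty c := hne.to_subtype
    obtain ⟨E', hE', haE⟩ : ∃ E' ∈ c, (a : L) ∈ E' := by
      have ha : ∀ z ∈ sSup c, ∃ E' ∈ c, z ∈ E' := fun z hz => by
        rw [sSup_eq_iSup', ← SetLike.mem_coe, coe_iSup_of_directed hc.directed,
          Set.mem_iUnion] at hz
        obtain ⟨E', hz⟩ := hz
        exact ⟨E', E'.2, hz⟩
      exact ha a a.2
    rcases hc.total hE hE' with hle | hle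
    · exact ⟨E', hE', ⟨a, haE⟩ * ⟨a, haE⟩ + inclusion hle y, by simp [hy],
        .sq_add _ (hys.map (inclusion hle))⟩
    · exact ⟨E, hE, ⟨a, hle haE⟩ * ⟨a, hle haE⟩ + y, by simp [hy], .sq_add _ hys⟩

theorem exists_polynomialIVT_algebra {K : Type*} [Field K] (hK : ¬ IsSumSq (-1 : K)) :
    ∃ (R : IntermediateField K (AlgebraicClosure K)) (_ : LinearOrder R),
      IsStrictOrderedRing R ∧ PolynomialIVT R := by
  obtain ⟨R, -, hR⟩ := zorn_le_nonempty₀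
    {E : IntermediateField K (AlgebraicClosure K) | ¬ IsSumSq (-1 : E)} (by
      intro c hcS hc E hE
      refine ⟨sSup c, fun h => ?_, fun F hF => le_sSup hF⟩
      obtain ⟨E', hE', y, hy, hys⟩ :=
        IntermediateField.exists_isSumSq_of_isSumSq_sSup hc ⟨E, hE⟩ h
      have : y = -1 := Subtype.ext (by simpa using hy)
      exact hcS hE' (this ▸ hys)) ⊥ (by
      intro h
      apply hK
      have := h.map (IntermediateField.botEquiv K (AlgebraicClosure K))
      simpa using this)
  have hmax : ∀ α : AlgebraicClosure K, α ∉ Set.range (algebraMap R (AlgebraicClosure K)) →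
      IsSumSq (-1 : IntermediateField.adjoin R {α}) := by
    intro α hα
    by_contra h
    have hle := hR.2 (y := (IntermediateField.adjoin R {α}).restrictScalars K) h (fun x hx => by
      exact (IntermediateField.adjoin R {α}).algebraMap_mem ⟨x, hx⟩)
    exact hα ⟨⟨α, hle (IntermediateField.mem_adjoin_simple_self R α)⟩, rfl⟩
  obtain ⟨l, hl⟩ := exists_linearOrder_of_isSumSq_or hR.1 (isSumSq_or_isSumSq_neg hR.1 hmax)
  exact ⟨R, l, hl, polynomialIVT_of_isSumSq_neg_one_adjoin hmax⟩

namespace Ideal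

variable {A : Type*} [CommRing A]

def IsReal (I : Ideal A) : Prop :=
  ∀ a s : A, IsSumSq s → a * a + s ∈ I → a ∈ I

theorem IsReal.mem_of_pow_mem {I : Ideal A} (hI : I.IsReal) {f : A} (k : ℕ) (hf : f ^ k ∈ I) :
    f ∈ I := by
  induction k using Nat.strong_induction_on with
  | _ k ih =>
  rcases k with _ | _ | k
  · rw [pow_zero, ← eq_top_iff_one] at hf
    simp [hf]
  · simpa using hf
  · refine ih (k + 1) (by omega) (hI _ 0 .zero ?_)
    have : f ^ (k + 1) * f ^ (k + 1) + 0 = f ^ k * f ^ (k + 1 + 1) := by ring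
    rw [this]
    exact I.mul_mem_left _ hf

def powAddSumSq (f : A) : Submonoid A where
  carrier := {x | ∃ (k : ℕ) (s : A), IsSumSq s ∧ x = f ^ k * f ^ k + s}
  one_mem' := ⟨0, 0, .zero, by simp⟩
  mul_mem' := by
    rintro _ _ ⟨k, s, hs, rfl⟩ ⟨l, t, ht, rfl⟩
    refine ⟨k + l, f ^ k * f ^ k * t + s * (f ^ l * f ^ l) + s * t, ?_, by ring⟩
    exact (((IsSumSq.mul_self _).mul ht).add (hs.mul (.mul_self _))).add (hs.mul ht)

theorem exists_le_isPrime_isReal {N : Ideal A} (hN : N.IsReal) {f : A} (hf : f ∉ N) :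
    ∃ p : Ideal A, N ≤ p ∧ p.IsPrime ∧ p.IsReal ∧ f ∉ p := by
  have hdisj : Disjoint (N : Set A) (powAddSumSq f) := by
    rw [Set.disjoint_left]
    rintro _ hx ⟨k, s, hs, rfl⟩
    exact hf (hN.mem_of_pow_mem k (hN _ _ hs hx))
  obtain ⟨p, hNp, hp⟩ := zorn_le_nonempty₀
    {J : Ideal A | Disjoint (J : Set A) (powAddSumSq f)} (by
      intro c hcS hc J hJ
      refine ⟨sSup c, ?_, fun z hz => le_sSup hz⟩
      refine Set.disjoint_left.2 ?_
      intro x hx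
      obtain ⟨J', hJ', hx'⟩ := (Submodule.mem_sSup_of_directed ⟨J, hJ⟩ hc.directedOn).1 hx
      exact Set.disjoint_left.1 (hcS hJ') hx') N hdisj
  have hmax : ∀ J : Ideal A, p < J → ¬ Disjoint (J : Set A) (powAddSumSq f) :=
    fun J hJ h => hJ.not_ge (hp.2 h hJ.le)
  refine ⟨p, hNp, isPrime_of_maximally_disjoint p _ hp.1 hmax, fun a s hs has => ?_, fun hfp => ?_⟩
  · by_contra ha
    have h := hmax (p ⊔ span {a}) (Submodule.lt_sup_iff_notMem.mpr ha)
    simp only [Set.not_disjoint_iff, SetLike.mem_coe, Submodule.mem_sup,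
      mem_span_singleton] at h
    obtain ⟨_, ⟨i, hi, _, ⟨r, rfl⟩, rfl⟩, hg⟩ := h
    obtain ⟨k, t, ht, hkt⟩ := (powAddSumSq f).mul_mem hg hg
    have : (i + a * r) * (i + a * r) + r * r * s =
        (i + 2 * a * r) * i + r * r * (a * a + s) := by ring
    have hmem : (i + a * r) * (i + a * r) + r * r * s ∈ (p : Set A) := by
      rw [this]
      exact p.add_mem (p.mul_mem_left _ hi) (p.mul_mem_left _ has)
    exact Set.disjoint_left.1 hp.1 hmem
      ⟨k, t + r * r * s, ht.add ((IsSumSq.mul_self _).mul hs), by rw [hkt]; ring⟩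
  · have hmem : f * f ∈ (p : Set A) := p.mul_mem_left _ hfp
    exact Set.disjoint_left.1 hp.1 hmem ⟨1, 0, .zero, by simp⟩

theorem IsReal.not_isSumSq_neg_one {K : Type*} [Field K] {φ : A →+* K}
    (hφ : (RingHom.ker φ).IsReal) (hsurj : ∀ x : K, ∃ u v, φ v ≠ 0 ∧ x * φ v = φ u) :
    ¬ IsSumSq (-1 : K) := by
  intro h
  have key : ∀ x : K, IsSumSq x → ∃ d s : A, φ d ≠ 0 ∧ IsSumSq s ∧ x * φ (d * d) = φ s := by
    intro x hx
    induction hx with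
    | zero => exact ⟨1, 0, by simp, .zero, by simp⟩
    | sq_add a hs ih =>
      obtain ⟨d, s, hd, hs, hds⟩ := ih
      obtain ⟨u, v, hv, huv⟩ := hsurj a
      refine ⟨v * d, (u * d) * (u * d) + v * v * s, by simp [hv, hd],
        .sq_add _ ((IsSumSq.mul_self _).mul hs), ?_⟩
      simp only [map_mul, map_add] at hds ⊢
      rw [← hds, ← huv]
      ring
  obtain ⟨d, s, hd, hs, hds⟩ := key _ h
  refine hd (hφ d s hs ?_)
  rw [RingHom.mem_ker, map_add, ← hds]
  ring

end Ideal

namespace MvPolynomial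

variable {n : ℕ}

theorem exists_real_aeval_eq_zero_iff_of_polynomialIVT {R : Type*} [Field R] [LinearOrder R]
    [IsStrictOrderedRing R] (hR : PolynomialIVT R) (φ : MvPolynomial (Fin n) ℝ →+* R)
    (F : Finset (MvPolynomial (Fin n) ℝ)) :
    ∃ y : Fin n → ℝ, ∀ f ∈ F, φ f = 0 ↔ aeval y f = 0 := by
  let _ : Algebra ℝ R := (φ.comp C).toAlgebra
  obtain ⟨y, hy⟩ := exists_real_sign_aeval_eq hR n F fun i => φ (X i)
  refine ⟨y, fun f hf => ?_⟩
  have hφ : φ = (aeval fun i => φ (X i) : MvPolynomial (Fin n) ℝ →ₐ[ℝ] R).toRingHom :=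
    ringHom_ext (fun r => (aeval_C (fun i => φ (X i)) r).symm) fun i =>
      (aeval_X (fun i => φ (X i)) i).symm
  rw [← sign_eq_zero_congr (hy f hf), hφ]
  simp

theorem exists_real_aeval_eq_zero_iff {K : Type*} [Field K] (hK : ¬ IsSumSq (-1 : K))
    (φ : MvPolynomial (Fin n) ℝ →+* K) (F : Finset (MvPolynomial (Fin n) ℝ)) :
    ∃ y : Fin n → ℝ, ∀ f ∈ F, φ f = 0 ↔ aeval y f = 0 := by
  obtain ⟨R, l, hl, hR⟩ := exists_polynomialIVT_algebra hK
  obtain ⟨y, hy⟩ := exists_real_aeval_eq_zero_iff_of_polynomialIVT hR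
    ((algebraMap K R).comp φ) F
  refine ⟨y, fun f hf => ?_⟩
  rw [← hy f hf]
  simp

theorem mem_of_isReal_of_forall_aeval_eq_zero {N : Ideal (MvPolynomial (Fin n) ℝ)}
    (hN : N.IsReal) {f : MvPolynomial (Fin n) ℝ}
    (hf : ∀ y : Fin n → ℝ, (∀ g ∈ N, aeval y g = 0) → aeval y f = 0) : f ∈ N := by
  classical
  by_contra hfN
  obtain ⟨p, hNp, hp, hpr, hfp⟩ := Ideal.exists_le_isPrime_isReal hN hfN
  obtain ⟨G, hG⟩ : N.FG := IsNoetherian.noetherian N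
  let φ : MvPolynomial (Fin n) ℝ →+* FractionRing (MvPolynomial (Fin n) ℝ ⧸ p) :=
    (algebraMap _ _).comp (Ideal.Quotient.mk p)
  have hker : ∀ g, φ g = 0 ↔ g ∈ p := fun g => by
    rw [RingHom.comp_apply, IsFractionRing.to_map_eq_zero_iff, Ideal.Quotient.eq_zero_iff_mem]
  have hK : ¬ IsSumSq (-1 : FractionRing (MvPolynomial (Fin n) ℝ ⧸ p)) := by
    refine Ideal.IsReal.not_isSumSq_neg_one (φ := φ) (by
      rwa [show RingHom.ker φ = p from Ideal.ext hker]) fun x => ?_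
    obtain ⟨u, v, hv, rfl⟩ := IsFractionRing.div_surjective (MvPolynomial (Fin n) ℝ ⧸ p) x
    obtain ⟨u, rfl⟩ := Ideal.Quotient.mk_surjective u
    obtain ⟨v, rfl⟩ := Ideal.Quotient.mk_surjective v
    have hv0 : φ v ≠ 0 :=
      IsFractionRing.to_map_ne_zero_of_mem_nonZeroDivisors
        (R := MvPolynomial (Fin n) ℝ ⧸ p) hv
    exact ⟨u, v, hv0, div_mul_cancel₀ _ hv0⟩
  obtain ⟨y, hy⟩ := exists_real_aeval_eq_zero_iff hK φ (insert f G)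
  refine hfp ((hker f).1 ((hy f (Finset.mem_insert_self _ _)).2 (hf y fun g hg => ?_)))
  have hle : N ≤ RingHom.ker (aeval y : MvPolynomial (Fin n) ℝ →ₐ[ℝ] ℝ) := by
    rw [← hG]
    refine Ideal.span_le.2 fun g hg => ?_
    exact (hy g (Finset.mem_insert_of_mem hg)).1
      ((hker g).2 (hNp (hG ▸ Ideal.subset_span hg)))
  exact hle hg

end MvPolynomial

end RealNullstellensatz

section PositiveDefinite

variable {n : ℕ}

theorem starC_map_ofReal (p : MvPolynomial (Fin n) ℝ) :
    starC (p.map Complex.ofRealHom) = p.map Complex.ofRealHom := by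
  rw [starC, MvPolynomial.map_map]
  rw [show (starRingEnd ℂ).comp Complex.ofRealHom = Complex.ofRealHom from
    RingHom.ext Complex.conj_ofReal]

theorem starC_C_I : starC (MvPolynomial.C Complex.I : MvPolynomial (Fin n) ℂ) =
    -MvPolynomial.C Complex.I := by
  simp [starC]

theorem evalC_map_ofReal (p : MvPolynomial (Fin n) ℝ) (x : Fin n → ℝ) :
    evalC (p.map Complex.ofRealHom) x = (MvPolynomial.aeval x p : ℝ) := by
  induction p using MvPolynomial.induction_on with
  | C a => simp [evalC]
  | add p q hp hq => simp_all [evalC]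
  | mul_X p i hp => simp_all [evalC]

theorem MvPolynomial.exists_eq_map_add_C_I_mul_map (P : MvPolynomial (Fin n) ℂ) :
    ∃ p q : MvPolynomial (Fin n) ℝ,
      P = p.map Complex.ofRealHom + C Complex.I * q.map Complex.ofRealHom := by
  induction P using MvPolynomial.induction_on with
  | C a =>
    refine ⟨C a.re, C a.im, ?_⟩
    rw [map_C, map_C, ← C_mul, ← C_add]
    congr 1
    rw [mul_comm]
    exact (Complex.re_add_im a).symm
  | add P Q hP hQ =>
    obtain ⟨p, q, rfl⟩ := hP
    obtain ⟨p', q', rfl⟩ := hQ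
    exact ⟨p + p', q + q', by simp only [map_add]; ring⟩
  | mul_X P i hP =>
    obtain ⟨p, q, rfl⟩ := hP
    exact ⟨p * X i, q * X i, by simp only [map_mul, map_X]; ring⟩

theorem evalC_map_add_C_I_mul_map_eq_zero_iff (p q : MvPolynomial (Fin n) ℝ) (x : Fin n → ℝ) :
    evalC (p.map Complex.ofRealHom + MvPolynomial.C Complex.I * q.map Complex.ofRealHom) x = 0 ↔
      MvPolynomial.aeval x p = 0 ∧ MvPolynomial.aeval x q = 0 := by
  have : evalC (p.map Complex.ofRealHom + MvPolynomial.C Complex.I * q.map Complex.ofRealHom) x =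
      (MvPolynomial.aeval x p : ℝ) + Complex.I * (MvPolynomial.aeval x q : ℝ) := by
    rw [← evalC_map_ofReal, ← evalC_map_ofReal]
    simp [evalC]
  rw [this, Complex.ext_iff]
  simp

theorem map_ofReal_mem_of_add_mem {I : Ideal (MvPolynomial (Fin n) ℂ)}
    (hstar : ∀ P ∈ I, starC P ∈ I) {p q : MvPolynomial (Fin n) ℝ}
    (h : p.map Complex.ofRealHom + MvPolynomial.C Complex.I * q.map Complex.ofRealHom ∈ I) :
    p.map Complex.ofRealHom ∈ I ∧ q.map Complex.ofRealHom ∈ I := by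
  have hs := hstar _ h
  have heq : starC (p.map Complex.ofRealHom +
      MvPolynomial.C Complex.I * q.map Complex.ofRealHom) =
      p.map Complex.ofRealHom - MvPolynomial.C Complex.I * q.map Complex.ofRealHom := by
    have : ∀ P Q R : MvPolynomial (Fin n) ℂ, starC (P + Q * R) = starC P + starC Q * starC R :=
      fun P Q R => by simp [starC]
    rw [this, starC_map_ofReal, starC_map_ofReal, starC_C_I]
    ring
  rw [heq] at hs
  have hI : (MvPolynomial.C Complex.I : MvPolynomial (Fin n) ℂ) * MvPolynomial.C Complex.I = -1 := by
    rw [← MvPolynomial.C_mul, Complex.I_mul_I]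
    simp
  have h2 : (MvPolynomial.C (1 / 2) : MvPolynomial (Fin n) ℂ) * 2 = 1 := by
    rw [← map_ofNat (MvPolynomial.C), ← MvPolynomial.C_mul]
    norm_num
  constructor
  · have := I.mul_mem_left (MvPolynomial.C (1 / 2)) (I.add_mem h hs)
    convert this using 1
    linear_combination (-p.map Complex.ofRealHom) * h2
  · have := I.mul_mem_left (-MvPolynomial.C (1 / 2) * MvPolynomial.C Complex.I) (I.sub_mem h hs)
    convert this using 1
    linear_combination (q.map Complex.ofRealHom) * (-h2 + MvPolynomial.C (1 / 2) * 2 * hI)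

def annihilatorOfReal (Λ : MvPolynomial (Fin n) ℂ →ₗ[ℂ] ℂ) : Ideal (MvPolynomial (Fin n) ℝ) where
  carrier := {p | ∀ q : MvPolynomial (Fin n) ℝ, Λ ((q * p).map Complex.ofRealHom) = 0}
  add_mem' := fun {a b} ha hb q => by rw [mul_add, map_add, map_add, ha, hb, add_zero]
  zero_mem' := fun q => by simp
  smul_mem' := fun c a ha q => by rw [smul_eq_mul, ← mul_assoc, ha]

variable {Λ : MvPolynomial (Fin n) ℂ →ₗ[ℂ] ℂ}

theorem IsPosDefC.map_mul_self_nonneg (hΛ : IsPosDefC Λ) (p : MvPolynomial (Fin n) ℝ) :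
    0 ≤ Λ ((p * p).map Complex.ofRealHom) := by
  simpa [starC_map_ofReal] using hΛ (p.map Complex.ofRealHom)

theorem IsPosDefC.isSumSq_nonneg (hΛ : IsPosDefC Λ) {s : MvPolynomial (Fin n) ℝ}
    (hs : IsSumSq s) : 0 ≤ Λ (s.map Complex.ofRealHom) := by
  induction hs with
  | zero => simp
  | sq_add a _ ih =>
    rw [map_add, map_add]
    exact add_nonneg (hΛ.map_mul_self_nonneg a) ih

theorem IsPosDefC.im_map_eq_zero (hΛ : IsPosDefC Λ) (p : MvPolynomial (Fin n) ℝ) :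
    (Λ (p.map Complex.ofRealHom)).im = 0 := by
  have h : ∀ q : MvPolynomial (Fin n) ℝ, (Λ ((q * q).map Complex.ofRealHom)).im = 0 :=
    fun q => (Complex.nonneg_iff.1 (hΛ.map_mul_self_nonneg q)).2.symm
  have h1 := h (p + 1)
  rw [show (p + 1) * (p + 1) = p * p + (p + (p + 1 * 1)) by ring] at h1
  simp only [map_add Λ, map_add (MvPolynomial.map Complex.ofRealHom), Complex.add_im, h] at h1
  linarith

theorem IsPosDefC.mem_annihilatorOfReal (hΛ : IsPosDefC Λ) {p : MvPolynomial (Fin n) ℝ}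
    (hp : Λ ((p * p).map Complex.ofRealHom) = 0) : p ∈ annihilatorOfReal Λ := by
  intro q
  refine Complex.ext ?_ (hΛ.im_map_eq_zero _)
  have h : ∀ t : ℝ, 0 ≤ (Λ ((q * q).map Complex.ofRealHom)).re +
      2 * t * (Λ ((q * p).map Complex.ofRealHom)).re := fun t => by
    have h1 := (Complex.nonneg_iff.1
      (hΛ.map_mul_self_nonneg (q + MvPolynomial.C t * p))).1
    have h2 : ((q + MvPolynomial.C t * p) * (q + MvPolynomial.C t * p)).map Complex.ofRealHom =
        (q * q).map Complex.ofRealHom + ((2 * t : ℝ) : ℂ) • (q * p).map Complex.ofRealHom +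
        ((t * t : ℝ) : ℂ) • (p * p).map Complex.ofRealHom := by
      simp only [MvPolynomial.smul_eq_C_mul, map_mul, map_add, MvPolynomial.map_C,
        Complex.ofReal_mul, Complex.ofRealHom_eq_coe, Complex.ofReal_ofNat, map_ofNat]
      ring
    rw [h2, map_add, map_add, map_smul, map_smul, hp] at h1
    simpa using h1
  set a := (Λ ((q * q).map Complex.ofRealHom)).re
  set b := (Λ ((q * p).map Complex.ofRealHom)).re
  by_contra hb
  have hb : b ≠ 0 := hb
  have := h (-(a + 1) / (2 * b))
  have h3 : 2 * (-(a + 1) / (2 * b)) * b = -(a + 1) := by field_simp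
  rw [h3] at this
  linarith

theorem IsPosDefC.isReal_annihilatorOfReal (hΛ : IsPosDefC Λ) :
    (annihilatorOfReal Λ).IsReal := by
  intro a s hs has
  apply hΛ.mem_annihilatorOfReal
  have h := has 1
  rw [one_mul, map_add, map_add] at h
  exact ((add_eq_zero_iff_of_nonneg (hΛ.map_mul_self_nonneg a) (hΛ.isSumSq_nonneg hs)).1 h).1

end PositiveDefinite

theorem stmt_9 (n : ℕ) (hn : 0 < n) (I : Ideal (MvPolynomial (Fin n) ℂ))
    (hstar : ∀ P ∈ I, starC P ∈ I)
    (Λ : MvPolynomial (Fin n) ℂ →ₗ[ℂ] ℂ) (hΛ : IsPosDefC Λ) :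
    VanishesOnC Λ I ↔ VanishesOnC Λ (vanishingIdealC (zeroSetC I)) := by
  refine ⟨fun h Q hQ => ?_, fun h P hP => h P fun x hx => hx P hP⟩
  have hI : ∀ p : MvPolynomial (Fin n) ℝ, p.map Complex.ofRealHom ∈ I →
      p ∈ annihilatorOfReal Λ := fun p hp q => by
    rw [map_mul]
    exact h _ (I.mul_mem_left _ hp)
  have hzero : ∀ y : Fin n → ℝ, (∀ g ∈ annihilatorOfReal Λ, MvPolynomial.aeval y g = 0) →
      y ∈ zeroSetC I := fun y hy P hP => by
    obtain ⟨p, q, rfl⟩ := P.exists_eq_map_add_C_I_mul_map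
    obtain ⟨hp, hq⟩ := map_ofReal_mem_of_add_mem hstar hP
    exact (evalC_map_add_C_I_mul_map_eq_zero_iff p q y).2 ⟨hy p (hI p hp), hy q (hI q hq)⟩
  obtain ⟨p, q, rfl⟩ := Q.exists_eq_map_add_C_I_mul_map
  have hpq : ∀ y : Fin n → ℝ, (∀ g ∈ annihilatorOfReal Λ, MvPolynomial.aeval y g = 0) →
      MvPolynomial.aeval y p = 0 ∧ MvPolynomial.aeval y q = 0 := fun y hy =>
    (evalC_map_add_C_I_mul_map_eq_zero_iff p q y).1 (hQ y (hzero y hy))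
  have hp := MvPolynomial.mem_of_isReal_of_forall_aeval_eq_zero hΛ.isReal_annihilatorOfReal
    (fun y hy => (hpq y hy).1) 1
  have hq := MvPolynomial.mem_of_isReal_of_forall_aeval_eq_zero hΛ.isReal_annihilatorOfReal
    (fun y hy => (hpq y hy).2) 1
  rw [one_mul] at hp hq
  rw [map_add, ← MvPolynomial.smul_eq_C_mul, map_smul, hp, hq, smul_zero, add_zero]
end
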